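/- arXiv:1709.08895 — 2 statements merged into one kernel-verified Lean document; each statement's English description precedes it below -/
import Mathlib

section
/- Let X be a complex Hilbert space and let A be the generator of a bounded C₀-semigroup (T(t))_{t≥0} on X. Suppose that σ(A) ∩ iℝ = {0} and that M₀, M_∞ : [1,∞) → (0,∞) are continuous non-decreasing functions such that sup_{s⁻¹ ≤ |r| ≤ 1} ‖R(ir,A)‖ ≤ M₀(s) and sup_{1 ≤ |r| ≤ s} ‖R(ir,A)‖ ≤ M_∞(s) for all s ≥ 1. Define M(s) = max{M₀(s), M_∞(s)}, s ≥ 1, and suppose that M has positive increase. Then ‖T(t)AR(1,A)²‖ = O(1/M⁻¹(t)) as t → ∞. -/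
open Filter Topology MeasureTheory

noncomputable section

/-- `T` is a (one-parameter) `C₀`-semigroup on `X`, indexed by `t ≥ 0`. -/
structure IsC0Semigroup {X : Type*} [NormedAddCommGroup X] [NormedSpace ℂ X]
    (T : ℝ → X →L[ℂ] X) : Prop where
  map_zero : T 0 = 1
  map_add : ∀ s t : ℝ, 0 ≤ s → 0 ≤ t → T (s + t) = T s ∘L T t
  strong_continuity : ∀ x : X, ContinuousOn (fun t => T t x) (Set.Ici (0 : ℝ))

/-- `A` (a closed, densely defined, partially defined linear operator) is the
infinitesimal generator of the semigroup `T`. -/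
structure IsGenerator {X : Type*} [NormedAddCommGroup X] [NormedSpace ℂ X]
    (T : ℝ → X →L[ℂ] X) (A : X →ₗ.[ℂ] X) : Prop where
  dense_domain : Dense (A.domain : Set X)
  mem_domain_iff : ∀ x : X, x ∈ A.domain ↔
    ∃ y : X, Tendsto (fun t : ℝ => t⁻¹ • (T t x - x)) (𝓝[>] (0 : ℝ)) (𝓝 y)
  tendsto_generator : ∀ x : A.domain,
    Tendsto (fun t : ℝ => t⁻¹ • (T t (x : X) - (x : X))) (𝓝[>] (0 : ℝ)) (𝓝 (A x))

/-- `R` is the resolvent operator `R(z, A) = (z I - A)⁻¹` of `A` at the point `z`;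
in particular `z` belongs to the resolvent set of `A`. -/
structure IsResolvent {X : Type*} [NormedAddCommGroup X] [NormedSpace ℂ X]
    (A : X →ₗ.[ℂ] X) (z : ℂ) (R : X →L[ℂ] X) : Prop where
  mem_domain : ∀ x : X, R x ∈ A.domain
  right_inv : ∀ x : X, z • R x - A ⟨R x, mem_domain x⟩ = x
  left_inv : ∀ x : A.domain, R (z • (x : X) - A x) = (x : X)

/-- The spectrum `σ(A)` of the partially defined operator `A`: the set of `z ∈ ℂ`
at which no (bounded, everywhere defined) resolvent operator for `A` exists. -/
def pmSpectrum {X : Type*} [NormedAddCommGroup X] [NormedSpace ℂ X]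
    (A : X →ₗ.[ℂ] X) : Set ℂ :=
  {z : ℂ | ¬∃ R : X →L[ℂ] X, IsResolvent A z R}

/-- `M : [a, ∞) → (0, ∞)` has positive increase: there are `α > 0`, `c ∈ (0,1]` and
`s₀ ≥ a` with `s₀ > 0` such that `M (λ s) / M s ≥ c λ^α` for all `λ ≥ 1`, `s ≥ s₀`. -/
def HasPosIncrease (a : ℝ) (M : ℝ → ℝ) : Prop :=
  ∃ α : ℝ, 0 < α ∧ ∃ c : ℝ, c ∈ Set.Ioc (0 : ℝ) 1 ∧ ∃ s₀ : ℝ, a ≤ s₀ ∧ 0 < s₀ ∧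
    ∀ lam : ℝ, 1 ≤ lam → ∀ s : ℝ, s₀ ≤ s → c * lam ^ α ≤ M (lam * s) / M s

/-- The right-continuous right-inverse `M⁻¹ t = sup {r ≥ a : M r ≤ t}` of a
continuous non-decreasing function `M` on `[a, ∞)` with `M s → ∞` as `s → ∞`. -/
def rcInv (a : ℝ) (M : ℝ → ℝ) (t : ℝ) : ℝ :=
  sSup {r : ℝ | a ≤ r ∧ M r ≤ t}

section Plancherel
open FourierTransform SchwartzMap

/-- Plancherel's theorem for functions in `L¹ ∩ L²`. -/
theorem eLpNorm_fourier_eq_of_integrable_of_memLp {X : Type*} [NormedAddCommGroup X]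
    [InnerProductSpace ℂ X] [CompleteSpace X] {f : ℝ → X} (hf : Integrable f)
    (hf₂ : MemLp f 2) : eLpNorm (𝓕 f) 2 = eLpNorm f 2 := by
  have hcont : Continuous (𝓕 f) :=
    VectorFourier.fourierIntegral_continuous Real.continuous_fourierChar
      (by exact continuous_inner) hf
  have key : (𝓕 (hf₂.toLp f) : Lp X 2 (volume : Measure ℝ)) =ᵐ[volume] 𝓕 f := by
    refine ae_eq_of_integral_contDiff_smul_eq
      ((Lp.memLp _).locallyIntegrable one_le_two) hcont.locallyIntegrable fun g hg hgc => ?_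
    have hg₁ : HasCompactSupport (Complex.ofRealCLM ∘ g) := hgc.comp_left rfl
    have hg₂ : ContDiff ℝ (⊤ : ℕ∞) (Complex.ofRealCLM ∘ g) := by fun_prop
    set φ : 𝓢(ℝ, ℂ) := hg₁.toSchwartzMap hg₂
    have hφ : ∀ x, (φ x : ℂ) = (g x : ℂ) := fun x => rfl
    have h₁ := congrArg (fun u => u φ) (Lp.fourier_toTemperedDistribution_eq (hf₂.toLp f))
    simp only [TemperedDistribution.fourier_apply, Lp.toTemperedDistribution_apply] at h₁
    calc ∫ x, g x • (𝓕 (hf₂.toLp f) : Lp X 2 (volume : Measure ℝ)) x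
        = ∫ x, φ x • (𝓕 (hf₂.toLp f) : Lp X 2 (volume : Measure ℝ)) x := by
          simp [hφ]
      _ = ∫ x, (𝓕 φ) x • f x := by
          rw [← h₁]
          refine integral_congr_ae ?_
          filter_upwards [hf₂.coeFn_toLp] with x hx
          rw [hx]
      _ = ∫ x, φ x • 𝓕 f x := by
          simpa using! VectorFourier.integral_bilin_fourierIntegral_eq_flip
            (ContinuousLinearMap.lsmul ℂ ℂ) (L := innerₗ ℝ) Real.continuous_fourierChar
            continuous_inner φ.integrable hf
      _ = ∫ x, g x • 𝓕 f x := by simp [hφ]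
  rw [← eLpNorm_congr_ae key, ← eLpNorm_congr_ae hf₂.coeFn_toLp]
  have := Lp.norm_fourier_eq (hf₂.toLp f)
  rw [Lp.norm_def, Lp.norm_def] at this
  exact (ENNReal.toReal_eq_toReal_iff' (Lp.eLpNorm_ne_top _) (Lp.eLpNorm_ne_top _)).1 this

end Plancherel

section Semigroup

variable {X : Type*} [NormedAddCommGroup X] [NormedSpace ℂ X]
  {T : ℝ → X →L[ℂ] X} {A : X →ₗ.[ℂ] X} {S : X →L[ℂ] X} {K : ℝ}

theorem IsResolvent.eq_zero_of_apply_eq_zero {z : ℂ} (hS : IsResolvent A z S) {x : X}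
    (hx : S x = 0) : x = 0 := by
  have h := hS.right_inv x
  have h0 : (⟨S x, hS.mem_domain x⟩ : A.domain) = 0 := Subtype.ext hx
  rw [h0, hx] at h
  simpa using h.symm

/-- The semigroup leaves the domain of its generator invariant and commutes with it there. -/
theorem IsGenerator.apply_mem_domain (hT : IsC0Semigroup T) (hA : IsGenerator T A) {t : ℝ}
    (ht : 0 ≤ t) (w : A.domain) :
    ∃ h : T t w ∈ A.domain, A ⟨T t w, h⟩ = T t (A w) := by
  have key : Tendsto (fun h : ℝ => h⁻¹ • (T h (T t (w : X)) - T t (w : X))) (𝓝[>] (0 : ℝ))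
      (𝓝 (T t (A w))) := by
    refine (((T t).continuous.tendsto _).comp (hA.tendsto_generator w)).congr' ?_
    filter_upwards [self_mem_nhdsWithin] with h hh
    have h1 : T h (T t (w : X)) = T t (T h (w : X)) := by
      rw [← ContinuousLinearMap.comp_apply, ← hT.map_add h t (le_of_lt hh) ht, add_comm,
        hT.map_add t h ht (le_of_lt hh), ContinuousLinearMap.comp_apply]
    rw [h1, Function.comp_apply, ← map_sub, (T t).map_smul_of_tower]
  have hmem : T t w ∈ A.domain := (hA.mem_domain_iff _).2 ⟨_, key⟩
  exact ⟨hmem, tendsto_nhds_unique (hA.tendsto_generator ⟨_, hmem⟩) key⟩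

theorem IsGenerator.commute_resolvent (hT : IsC0Semigroup T) (hA : IsGenerator T A) {z : ℂ}
    (hS : IsResolvent A z S) {t : ℝ} (ht : 0 ≤ t) (x : X) : T t (S x) = S (T t x) := by
  obtain ⟨h, hAh⟩ := hA.apply_mem_domain hT ht ⟨S x, hS.mem_domain x⟩
  have h1 := hS.left_inv ⟨_, h⟩
  rw [hAh, ← map_smul, ← map_sub, hS.right_inv] at h1
  exact h1.symm

theorem IsGenerator.hasDerivWithinAt (hT : IsC0Semigroup T) (hA : IsGenerator T A) {t : ℝ}
    (ht : 0 ≤ t) (w : A.domain) :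
    HasDerivWithinAt (fun s => T s (w : X)) (T t (A w)) (Set.Ioi t) t := by
  rw [hasDerivWithinAt_iff_tendsto_slope' (by simp)]
  have h1 : Tendsto (fun s : ℝ => s - t) (𝓝[>] t) (𝓝[>] 0) := by
    refine tendsto_nhdsWithin_iff.2 ⟨?_, ?_⟩
    · have : Tendsto (fun s : ℝ => s - t) (𝓝 t) (𝓝 (t - t)) :=
        (continuous_id.sub continuous_const).tendsto t
      rw [sub_self] at this
      exact this.mono_left nhdsWithin_le_nhds
    · filter_upwards [self_mem_nhdsWithin] with s hs
      exact sub_pos.2 (Set.mem_Ioi.1 hs)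
  refine ((((T t).continuous.tendsto _).comp (hA.tendsto_generator w)).comp h1).congr' ?_
  filter_upwards [self_mem_nhdsWithin] with s hs
  have h2 : T s = T t ∘L T (s - t) := by
    rw [← hT.map_add t (s - t) ht (sub_nonneg.2 (le_of_lt hs)), add_sub_cancel]
  rw [slope_def_module, h2]
  simp [(T t).map_smul_of_tower]

/-- The Laplace-type integral `∫₀^∞ s ^ m e ^ (-z s) T(s) x ds`. -/
def laplaceMoment (T : ℝ → X →L[ℂ] X) (m : ℕ) (z : ℂ) (x : X) : X :=
  ∫ s in Set.Ioi (0 : ℝ), ((s : ℂ) ^ m * Complex.exp (-z * s)) • T s x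

theorem integrableOn_pow_mul_exp_neg_mul (m : ℕ) {a : ℝ} (ha : 0 < a) :
    IntegrableOn (fun s : ℝ => s ^ m * Real.exp (-a * s)) (Set.Ioi 0) := by
  simpa using integrableOn_rpow_mul_exp_neg_mul_rpow (p := 1) (s := m) (b := a)
    (by linarith [(Nat.cast_nonneg m : (0 : ℝ) ≤ m)]) one_pos ha

theorem norm_pow_mul_exp_smul_le (hK : ∀ t : ℝ, 0 ≤ t → ‖T t‖ ≤ K) (m : ℕ) (z : ℂ) (x : X)
    {s : ℝ} (hs : 0 ≤ s) :
    ‖((s : ℂ) ^ m * Complex.exp (-z * s)) • T s x‖ ≤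
      K * ‖x‖ * (s ^ m * Real.exp (-z.re * s)) := by
  rw [norm_smul, norm_mul, norm_pow, Complex.norm_real, Complex.norm_exp, Real.norm_of_nonneg hs]
  have : (-z * s).re = -z.re * s := by simp
  rw [this, mul_comm]
  gcongr
  exact (T s).le_of_opNorm_le (hK s hs) x

theorem IsC0Semigroup.integrableOn_moment (hT : IsC0Semigroup T)
    (hK : ∀ t : ℝ, 0 ≤ t → ‖T t‖ ≤ K) (m : ℕ) {z : ℂ} (hz : 0 < z.re) (x : X) :
    IntegrableOn (fun s : ℝ => ((s : ℂ) ^ m * Complex.exp (-z * s)) • T s x) (Set.Ioi 0) := by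
  refine ((integrableOn_pow_mul_exp_neg_mul m hz).const_mul (K * ‖x‖)).mono' ?_ ?_
  · refine ContinuousOn.aestronglyMeasurable ?_ measurableSet_Ioi
    refine ContinuousOn.smul (by fun_prop) ((hT.strong_continuity x).mono Set.Ioi_subset_Ici_self)
  · filter_upwards [ae_restrict_mem measurableSet_Ioi] with s hs
    exact norm_pow_mul_exp_smul_le hK m z x (le_of_lt hs)

theorem IsC0Semigroup.norm_laplaceMoment_zero_le
    (hK : ∀ t : ℝ, 0 ≤ t → ‖T t‖ ≤ K) {z : ℂ} (hz : 0 < z.re) (x : X) :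
    ‖laplaceMoment T 0 z x‖ ≤ K / z.re * ‖x‖ := by
  have h1 : ∫ s in Set.Ioi (0 : ℝ), Real.exp (-z.re * s) = 1 / z.re := by
    rw [integral_exp_mul_Ioi (by linarith) 0]; simp
  calc ‖laplaceMoment T 0 z x‖
      ≤ ∫ s in Set.Ioi (0 : ℝ), K * ‖x‖ * (s ^ 0 * Real.exp (-z.re * s)) := by
        refine norm_integral_le_of_norm_le
          ((integrableOn_pow_mul_exp_neg_mul 0 hz).const_mul (K * ‖x‖)) ?_
        filter_upwards [ae_restrict_mem measurableSet_Ioi] with s hs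
        exact norm_pow_mul_exp_smul_le hK 0 z x (le_of_lt hs)
    _ = K / z.re * ‖x‖ := by
        simp only [pow_zero, one_mul]
        rw [integral_const_mul, h1]; ring

theorem laplaceMoment_map [CompleteSpace X] (hT : IsC0Semigroup T)
    (hK : ∀ t : ℝ, 0 ≤ t → ‖T t‖ ≤ K) (hcomm : ∀ t : ℝ, 0 ≤ t → ∀ x, T t (S x) = S (T t x))
    (m : ℕ) {z : ℂ} (hz : 0 < z.re) (x : X) :
    laplaceMoment T m z (S x) = S (laplaceMoment T m z x) := by
  rw [laplaceMoment, laplaceMoment, ← S.integral_comp_comm (hT.integrableOn_moment hK m hz x)]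
  refine setIntegral_congr_fun measurableSet_Ioi fun s hs => ?_
  simp [hcomm s (le_of_lt hs)]

theorem laplaceMoment_add (hT : IsC0Semigroup T)
    (hK : ∀ t : ℝ, 0 ≤ t → ‖T t‖ ≤ K) (m : ℕ) {z : ℂ} (hz : 0 < z.re) (x y : X) :
    laplaceMoment T m z (x + y) = laplaceMoment T m z x + laplaceMoment T m z y := by
  rw [laplaceMoment, laplaceMoment, laplaceMoment,
    ← integral_add (hT.integrableOn_moment hK m hz x) (hT.integrableOn_moment hK m hz y)]
  simp only [map_add, smul_add]

theorem laplaceMoment_smul (m : ℕ) (z c : ℂ) (x : X) :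
    laplaceMoment T m z (c • x) = c • laplaceMoment T m z x := by
  rw [laplaceMoment, laplaceMoment, ← integral_smul]
  congr 1; ext s
  rw [map_smul, smul_comm]

/-- Integration by parts for the Laplace-type integrals of an orbit. -/
theorem IsGenerator.integral_deriv_moment [CompleteSpace X] (hT : IsC0Semigroup T)
    (hA : IsGenerator T A) (hK : ∀ t : ℝ, 0 ≤ t → ‖T t‖ ≤ K) (m : ℕ) {z : ℂ} (hz : 0 < z.re)
    (w : A.domain) :
    (m : ℂ) • laplaceMoment T (m - 1) z w - laplaceMoment T m z (z • (w : X) - A w) =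
      -((0 : ℂ) ^ m • (w : X)) := by
  set φ : ℝ → ℂ := fun s => (s : ℂ) ^ m * Complex.exp (-z * s) with hφ
  set g : ℝ → X := fun s => (m : ℂ) • (((s : ℂ) ^ (m - 1) * Complex.exp (-z * s)) • T s (w : X))
    - ((s : ℂ) ^ m * Complex.exp (-z * s)) • T s (z • (w : X) - A w) with hg
  have hgi : IntegrableOn g (Set.Ioi 0) :=
    ((hT.integrableOn_moment hK (m - 1) hz (w : X)).smul (m : ℂ)).sub
      (hT.integrableOn_moment hK m hz _)
  have hlhs : (m : ℂ) • laplaceMoment T (m - 1) z w - laplaceMoment T m z (z • (w : X) - A w) =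
      ∫ s in Set.Ioi (0 : ℝ), g s := by
    rw [laplaceMoment, laplaceMoment, ← integral_smul]
    exact (integral_sub ((hT.integrableOn_moment hK (m - 1) hz (w : X)).smul (m : ℂ))
      (hT.integrableOn_moment hK m hz _)).symm
  have hderiv : ∀ s : ℝ, 0 ≤ s →
      HasDerivWithinAt (fun s => φ s • T s (w : X)) (g s) (Set.Ioi s) s := by
    intro s hs
    have hexp : HasDerivAt (fun s : ℝ => Complex.exp (-z * s)) (Complex.exp (-z * s) * (-z)) s := by
      have : HasDerivAt (fun s : ℝ => -z * (s : ℂ)) (-z) s := by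
        simpa using (Complex.ofRealCLM.hasDerivAt (x := s)).const_mul (-z)
      exact this.cexp
    have hpow : HasDerivAt (fun s : ℝ => (s : ℂ) ^ m) ((m : ℂ) * (s : ℂ) ^ (m - 1)) s := by
      simpa using! (Complex.ofRealCLM.hasDerivAt (x := s)).pow m
    have h := (hpow.mul hexp).hasDerivWithinAt.smul (hA.hasDerivWithinAt hT hs w)
    refine h.congr_deriv ?_
    simp only [hg, map_sub, map_smul, Pi.mul_apply]
    module
  have hcont : ContinuousOn (fun s => φ s • T s (w : X)) (Set.Ici 0) :=
    ContinuousOn.smul (by fun_prop) (hT.strong_continuity (w : X))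
  have hFTC : ∀ b : ℝ, 0 ≤ b →
      ∫ s in (0 : ℝ)..b, g s = φ b • T b (w : X) - φ 0 • T 0 (w : X) := by
    intro b hb
    refine intervalIntegral.integral_eq_sub_of_hasDeriv_right_of_le hb
      (hcont.mono Set.Icc_subset_Ici_self) (fun s hs => hderiv s hs.1.le) ?_
    rw [intervalIntegrable_iff_integrableOn_Ioc_of_le hb]
    exact hgi.mono_set Set.Ioc_subset_Ioi_self
  have hlim : Tendsto (fun b : ℝ => φ b • T b (w : X)) atTop (𝓝 0) := by
    have h0 : Tendsto (fun b : ℝ => K * ‖(w : X)‖ * (b ^ m * Real.exp (-z.re * b))) atTop (𝓝 0) := by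
      have := tendsto_rpow_mul_exp_neg_mul_atTop_nhds_zero m z.re hz
      simpa using this.const_mul (K * ‖(w : X)‖)
    refine squeeze_zero_norm' ?_ h0
    filter_upwards [eventually_ge_atTop 0] with b hb
    exact norm_pow_mul_exp_smul_le hK m z w hb
  have hint := intervalIntegral_tendsto_integral_Ioi 0 hgi tendsto_id
  have hlim' : Tendsto (fun b : ℝ => ∫ s in (0 : ℝ)..b, g s) atTop
      (𝓝 (0 - φ 0 • T 0 (w : X))) := by
    refine (hlim.sub_const _).congr' ?_
    filter_upwards [eventually_ge_atTop 0] with b hb using (hFTC b hb).symm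
  rw [hlhs, tendsto_nhds_unique hint hlim', hT.map_zero]
  simp [hφ]

end Semigroup

section Resolvent

variable {X : Type*} [NormedAddCommGroup X] [NormedSpace ℂ X]
  {T : ℝ → X →L[ℂ] X} {A : X →ₗ.[ℂ] X} {S : X →L[ℂ] X} {K : ℝ}

theorem IsResolvent.smul_sub_apply {w : ℂ} (hS : IsResolvent A w S) (z : ℂ) (x : X) :
    z • S x - A ⟨S x, hS.mem_domain x⟩ = x + (z - w) • S x := by
  have h : A ⟨S x, hS.mem_domain x⟩ = w • S x - x := by
    rw [eq_sub_iff_add_eq, ← eq_sub_iff_add_eq']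
    exact (hS.right_inv x).symm
  rw [h]
  module

/-- The Laplace transform of a bounded semigroup as a bounded operator: it satisfies the
resolvent identity with `S = R(1, A)`, and its powers are the higher Laplace-type integrals. -/
theorem IsGenerator.exists_laplace_resolvent [CompleteSpace X] (hT : IsC0Semigroup T)
    (hA : IsGenerator T A) (hK : ∀ t : ℝ, 0 ≤ t → ‖T t‖ ≤ K) (hS : IsResolvent A 1 S) {z : ℂ}
    (hz : 0 < z.re) :
    ∃ R : X →L[ℂ] X, ‖R‖ ≤ K / z.re ∧ Commute R S ∧ R * (1 + (z - 1) • S) = S ∧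
      ∀ (m : ℕ) (x : X), laplaceMoment T m z x = (m.factorial : ℂ) • (R ^ (m + 1)) x := by
  have hK0 : 0 ≤ K := (norm_nonneg _).trans (hK 0 le_rfl)
  have hcomm := fun t (ht : 0 ≤ t) x => hA.commute_resolvent hT hS (t := t) ht x
  let R : X →L[ℂ] X := LinearMap.mkContinuous
    { toFun := laplaceMoment T 0 z
      map_add' := laplaceMoment_add hT hK 0 hz
      map_smul' := laplaceMoment_smul 0 z } (K / z.re)
    (IsC0Semigroup.norm_laplaceMoment_zero_le hK hz)
  have hR : ∀ x, R x = laplaceMoment T 0 z x := fun _ => rfl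
  have hRS : ∀ x, R (S x) = S (R x) := laplaceMoment_map hT hK hcomm 0 hz
  have hparts := fun m x => hA.integral_deriv_moment hT hK m hz ⟨S x, hS.mem_domain x⟩
  simp only [hS.smul_sub_apply] at hparts
  have hzero : ∀ x, R (x + (z - 1) • S x) = S x := by
    intro x
    have h := hparts 0 x
    rw [hR]
    simpa using h
  have hsucc : ∀ m x, laplaceMoment T (m + 1) z (x + (z - 1) • S x) =
      ((m + 1 : ℕ) : ℂ) • laplaceMoment T m z (S x) := by
    intro m x
    have h := hparts (m + 1) x
    simp only [Nat.add_sub_cancel, ne_eq, Nat.succ_ne_zero, not_false_eq_true, zero_pow, zero_smul,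
      neg_zero, sub_eq_zero] at h
    exact h.symm
  have hinj : ∀ x, x + (z - 1) • S x = 0 → x = 0 := by
    intro x hx
    refine hS.eq_zero_of_apply_eq_zero ?_
    rw [← hzero x, hx, map_zero]
  have hstep : ∀ m x, laplaceMoment T (m + 1) z x =
      ((m + 1 : ℕ) : ℂ) • laplaceMoment T m z (R x) := by
    intro m x
    rw [← sub_eq_zero]
    apply hinj
    have h := hsucc m x
    have h1 : laplaceMoment T m z (S x) =
        laplaceMoment T m z (R x) + (z - 1) • S (laplaceMoment T m z (R x)) := by
      rw [← hzero x, map_add, map_smul, laplaceMoment_add hT hK _ hz, laplaceMoment_smul, hRS,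
        laplaceMoment_map hT hK hcomm _ hz]
    rw [h1, laplaceMoment_add hT hK _ hz, laplaceMoment_smul,
      laplaceMoment_map hT hK hcomm _ hz] at h
    rw [map_sub, map_smul, ← sub_eq_zero.2 h]
    module
  refine ⟨R, LinearMap.mkContinuous_norm_le _ (div_nonneg hK0 hz.le) _, ?_, ?_, ?_⟩
  · ext x
    exact hRS x
  · ext x
    exact hzero x
  · intro m
    induction m with
    | zero => intro x; simp [hR]
    | succ m ih =>
      intro x
      rw [hstep, ih, smul_smul, pow_succ _ (m + 1), Nat.factorial_succ]
      push_cast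
      rfl

theorem IsResolvent.mul_eq {z : ℂ} {P : X →L[ℂ] X} (hP : IsResolvent A z P)
    (hS : IsResolvent A 1 S) : P * (1 + (z - 1) • S) = S := by
  ext x
  have h := hP.left_inv ⟨S x, hS.mem_domain x⟩
  rw [hS.smul_sub_apply] at h
  exact h

theorem IsResolvent.commute {z : ℂ} {P : X →L[ℂ] X} (hP : IsResolvent A z P)
    (hS : IsResolvent A 1 S) (hz : z ≠ 1) : Commute P S := by
  ext x
  have h1 : P x + (z - 1) • P (S x) = S x := by
    simpa using congrArg (fun L : X →L[ℂ] X => L x) (hP.mul_eq hS)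
  have h2 := hS.left_inv ⟨P x, hP.mem_domain x⟩
  have h3 : (1 : ℂ) • P x - A ⟨P x, hP.mem_domain x⟩ = x - (z - 1) • P x := by
    rw [hP.smul_sub_apply]
    module
  simp only [h3, map_sub, map_smul] at h2
  have h4 : (z - 1) • (P (S x) - S (P x)) = 0 := by
    rw [smul_sub, sub_eq_zero]
    rw [sub_eq_iff_eq_add] at h2
    exact add_left_cancel (h1.trans h2)
  exact sub_eq_zero.1 ((smul_eq_zero.1 h4).resolve_left (sub_ne_zero.2 hz))

theorem resolvent_eq_sub_mul {R P : X →L[ℂ] X} {z w : ℂ} (hinj : ∀ x, S x = 0 → x = 0)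
    (hRc : Commute R S) (hR : R * (1 + (z - 1) • S) = S) (hPc : Commute P S)
    (hP : P * (1 + (w - 1) • S) = S) : R = P - (z - w) • (P * R) := by
  have h1 : S * R = S * (P - (z - w) • (P * R)) := by
    have h2 : R * (1 + (w - 1) • S) = S - (z - w) • (R * S) := by
      rw [mul_add, mul_one, mul_smul_comm, ← eq_sub_iff_add_eq] at hR
      rw [mul_add, mul_one, mul_smul_comm]
      nth_rewrite 1 [hR]
      module
    have h3 : Commute (1 + (w - 1) • S) R :=
      ((Commute.one_right R).add_right (hRc.smul_right _)).symm
    calc S * R = P * ((1 + (w - 1) • S) * R) := by rw [← mul_assoc, hP]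
      _ = P * (S - (z - w) • (R * S)) := by rw [h3.eq, h2]
      _ = S * (P - (z - w) • (P * R)) := by
        simp only [mul_sub, mul_smul_comm, hRc.eq, hPc.eq, ← mul_assoc]
  ext x
  have h4 := congrArg (fun L : X →L[ℂ] X => L x) h1
  rw [← sub_eq_zero]
  apply hinj
  rw [map_sub, sub_eq_zero]
  exact h4

theorem norm_clm_pow_le {R : X →L[ℂ] X} {N : ℝ} (hN : ‖R‖ ≤ N) (m : ℕ) : ‖R ^ m‖ ≤ N ^ m := by
  rcases m.eq_zero_or_pos with rfl | hm
  · rw [pow_zero, pow_zero]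
    exact ContinuousLinearMap.norm_id_le
  · exact (norm_pow_le' R hm).trans (pow_le_pow_left₀ (norm_nonneg _) hN m)

theorem norm_pow_mul_le_of_im {R : X →L[ℂ] X} {z : ℂ} {N : ℝ}
    (hR : R * (1 + (z - 1) • S) = S) (hN : ‖R‖ ≤ N) (hN1 : 1 ≤ N) (hz : z.im ≠ 0) (m : ℕ) :
    ‖R ^ (m + 1) * ((S - 1) * S)‖ ≤ N ^ (m + 1) * ((‖S‖ + 1) ^ 2 / |z.im|) := by
  have h1 : (z - 1) • (R ^ (m + 1) * ((S - 1) * S)) = R ^ m * ((S - R) * (S - 1)) := by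
    have : S - R = (z - 1) • (R * S) := by
      rw [mul_add, mul_one, mul_smul_comm] at hR
      rw [sub_eq_iff_eq_add', hR]
    rw [this, pow_succ, smul_mul_assoc, mul_smul_comm]
    congr 1
    noncomm_ring
  have h2 : |z.im| ≤ ‖z - 1‖ := by simpa using Complex.abs_im_le_norm (z - 1)
  have hS1 : ‖S - 1‖ ≤ ‖S‖ + 1 :=
    (norm_sub_le _ _).trans (add_le_add_right (ContinuousLinearMap.norm_id_le (𝕜 := ℂ) (E := X)) _)
  have h3 : ‖(S - R) * (S - 1)‖ ≤ N * (‖S‖ + 1) ^ 2 := by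
    calc ‖(S - R) * (S - 1)‖ ≤ (‖S‖ + N) * (‖S‖ + 1) :=
          (norm_mul_le _ _).trans (mul_le_mul ((norm_sub_le _ _).trans (by gcongr)) hS1
            (norm_nonneg _) (by positivity))
      _ ≤ N * (‖S‖ + 1) ^ 2 := by
        nlinarith [norm_nonneg S, mul_nonneg (sub_nonneg.2 hN1) (norm_nonneg S)]
  rw [← mul_div_assoc, le_div_iff₀ (abs_pos.2 hz)]
  calc ‖R ^ (m + 1) * ((S - 1) * S)‖ * |z.im|
      ≤ ‖R ^ (m + 1) * ((S - 1) * S)‖ * ‖z - 1‖ := by gcongr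
    _ = ‖R ^ m * ((S - R) * (S - 1))‖ := by rw [← h1, norm_smul, mul_comm]
    _ ≤ N ^ m * (N * (‖S‖ + 1) ^ 2) :=
      (norm_mul_le _ _).trans (mul_le_mul (norm_clm_pow_le hN m) h3 (norm_nonneg _) (by positivity))
    _ = N ^ (m + 1) * (‖S‖ + 1) ^ 2 := by ring

theorem norm_pow_mul_le_of_norm {R : X →L[ℂ] X} {z : ℂ} {N : ℝ}
    (hR : R * (1 + (z - 1) • S) = S) (hN : ‖R‖ ≤ N) (hN0 : 0 < N) (m : ℕ) :
    ‖R ^ (m + 1) * ((S - 1) * S)‖ ≤ N ^ (m + 1) * ((‖z‖ + N⁻¹) * ‖S‖ ^ 2) := by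
  have h1 : R ^ (m + 1) * ((S - 1) * S) = R ^ m * ((z • (R * S) - S) * S) := by
    have : R * (S - 1) = z • (R * S) - S := by
      nth_rewrite 3 [← hR]
      rw [mul_add, mul_one, mul_smul_comm, mul_sub, mul_one, sub_smul, one_smul]
      abel
    rw [← this, pow_succ]
    noncomm_ring
  have h2 : ‖z • (R * S) - S‖ ≤ ‖z‖ * (N * ‖S‖) + ‖S‖ := by
    refine (norm_sub_le _ _).trans ?_
    rw [norm_smul]
    gcongr
    exact (norm_mul_le _ _).trans (by gcongr)
  rw [h1]
  calc ‖R ^ m * ((z • (R * S) - S) * S)‖ ≤ N ^ m * ((‖z‖ * (N * ‖S‖) + ‖S‖) * ‖S‖) :=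
        (norm_mul_le _ _).trans (mul_le_mul (norm_clm_pow_le hN m)
          ((norm_mul_le _ _).trans (by gcongr)) (norm_nonneg _) (by positivity))
    _ = N ^ (m + 1) * ((‖z‖ + N⁻¹) * ‖S‖ ^ 2) := by field_simp; ring

/-- The resolvent on the imaginary axis is at least the inverse distance to the spectral value
`0`. -/
theorem IsResolvent.one_le_mul_norm [CompleteSpace X] {z : ℂ} {P : X →L[ℂ] X}
    (hP : IsResolvent A z P) (h0 : (0 : ℂ) ∈ pmSpectrum A) : 1 ≤ ‖z‖ * ‖P‖ := by
  by_contra! hlt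
  rw [← norm_smul] at hlt
  refine h0 ?_
  let u := Units.oneSub (z • P) hlt
  have hu : (u : X →L[ℂ] X) = 1 - z • P := rfl
  have hcomm : Commute P (u : X →L[ℂ] X) := by
    rw [hu]
    exact (Commute.one_right P).sub_right ((Commute.refl P).smul_right z)
  have hcomm' : Commute P ((u⁻¹ : (X →L[ℂ] X)ˣ) : X →L[ℂ] X) := hcomm.units_inv_right
  have huv : ∀ x, u.val (u⁻¹.val x) = x := fun x =>
    congrArg (fun L : X →L[ℂ] X => L x) u.mul_inv
  have hvu : ∀ x, u⁻¹.val (u.val x) = x := fun x =>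
    congrArg (fun L : X →L[ℂ] X => L x) u.inv_mul
  refine ⟨P * u⁻¹.val, ⟨fun x => hP.mem_domain _, fun x => ?_, fun x => ?_⟩⟩
  · have h := huv x
    rw [hu, sub_apply, one_apply_eq_self, smul_apply, sub_eq_add_neg, ← neg_smul,
      ← zero_sub z] at h
    exact (hP.smul_sub_apply 0 _).trans h
  · rw [hcomm'.eq, zero_smul, zero_sub]
    have h := hP.left_inv x
    have h2 : P (-A x) = u.val (x : X) := by
      rw [map_sub, map_smul, sub_eq_iff_eq_add'] at h
      rw [hu]
      simp only [sub_apply, one_apply_eq_self, smul_apply, map_neg]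
      rw [h]
      abel
    rw [mul_apply_eq_comp, h2, hvu]

end Resolvent

section TimeDomain
open FourierTransform

variable {X : Type*} [NormedAddCommGroup X] [InnerProductSpace ℂ X]
  {T : ℝ → X →L[ℂ] X} {K : ℝ}

/-- The weighted orbit `s ↦ s ^ m e ^ (-a s) T(s) x`, extended by zero to negative times. -/
def weightedOrbit (T : ℝ → X →L[ℂ] X) (m : ℕ) (a : ℝ) (x : X) : ℝ → X :=
  (Set.Ioi (0 : ℝ)).indicator fun s => ((s : ℂ) ^ m * Complex.exp (-(a : ℂ) * s)) • T s x

theorem integrable_weightedOrbit (hT : IsC0Semigroup T) (hK : ∀ t : ℝ, 0 ≤ t → ‖T t‖ ≤ K)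
    (m : ℕ) {a : ℝ} (ha : 0 < a) (x : X) : Integrable (weightedOrbit T m a x) :=
  (integrable_indicator_iff measurableSet_Ioi).2
    (hT.integrableOn_moment hK m (z := a) (by simpa using ha) x)

theorem norm_weightedOrbit_le (hK : ∀ t : ℝ, 0 ≤ t → ‖T t‖ ≤ K) (m : ℕ) (a : ℝ) (x : X) (s : ℝ) :
    ‖weightedOrbit T m a x s‖ ≤
      (Set.Ioi (0 : ℝ)).indicator (fun s => K * ‖x‖ * (s ^ m * Real.exp (-a * s))) s := by
  rw [weightedOrbit]
  by_cases hs : s ∈ Set.Ioi (0 : ℝ)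
  · rw [Set.indicator_of_mem hs, Set.indicator_of_mem hs]
    exact norm_pow_mul_exp_smul_le hK m a x (le_of_lt hs)
  · rw [Set.indicator_of_notMem hs, Set.indicator_of_notMem hs, norm_zero]

theorem memLp_expDecay (m : ℕ) {a : ℝ} (ha : 0 < a) (c : ℝ) :
    MemLp ((Set.Ioi (0 : ℝ)).indicator (fun s => c * (s ^ m * Real.exp (-a * s)))) 2 := by
  rw [memLp_indicator_iff_restrict measurableSet_Ioi, memLp_two_iff_integrable_sq_norm
    (by fun_prop)]
  convert! (integrableOn_pow_mul_exp_neg_mul (2 * m) (a := 2 * a) (by positivity)).const_mul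
    (c ^ 2) using 2 with s
  rw [Real.norm_eq_abs, sq_abs, mul_pow, mul_pow, ← pow_mul, ← Real.exp_nat_mul, mul_comm m]
  push_cast
  ring_nf

theorem memLp_weightedOrbit (hT : IsC0Semigroup T) (hK : ∀ t : ℝ, 0 ≤ t → ‖T t‖ ≤ K)
    (m : ℕ) {a : ℝ} (ha : 0 < a) (x : X) : MemLp (weightedOrbit T m a x) 2 :=
  (memLp_expDecay m ha _).mono' (integrable_weightedOrbit hT hK m ha x).aestronglyMeasurable
    (ae_of_all _ (norm_weightedOrbit_le hK m a x))

theorem fourier_weightedOrbit (m : ℕ) (a : ℝ) (x : X) (ξ : ℝ) :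
    𝓕 (weightedOrbit T m a x) ξ =
      laplaceMoment T m (a + ((2 * Real.pi * ξ : ℝ) : ℂ) * Complex.I) x := by
  rw [Real.fourier_real_eq_integral_exp_smul, laplaceMoment,
    ← integral_indicator measurableSet_Ioi]
  congr 1 with s
  rw [weightedOrbit]
  by_cases hs : s ∈ Set.Ioi (0 : ℝ)
  · rw [Set.indicator_of_mem hs, Set.indicator_of_mem hs, smul_smul, mul_left_comm,
      ← Complex.exp_add]
    congr 3
    push_cast
    ring
  · rw [Set.indicator_of_notMem hs, Set.indicator_of_notMem hs, smul_zero]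

theorem eLpNorm_weightedOrbit_zero_le (hK0 : 0 ≤ K) (hK : ∀ t : ℝ, 0 ≤ t → ‖T t‖ ≤ K)
    {a : ℝ} (ha : 0 < a) (x : X) :
    eLpNorm (weightedOrbit T 0 a x) 2 ≤ ENNReal.ofReal (K * ‖x‖ * (2 * a)⁻¹ ^ (2⁻¹ : ℝ)) := by
  refine (eLpNorm_mono_real (norm_weightedOrbit_le hK 0 a x)).trans ?_
  rw [(memLp_expDecay 0 ha _).eLpNorm_eq_integral_rpow_norm two_ne_zero ENNReal.ofNat_ne_top]
  have h1 : ∀ s : ℝ, ‖(Set.Ioi (0 : ℝ)).indicator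
      (fun s => K * ‖x‖ * (s ^ 0 * Real.exp (-a * s))) s‖ ^ (2 : ENNReal).toReal =
      (Set.Ioi (0 : ℝ)).indicator (fun s => (K * ‖x‖) ^ 2 * Real.exp (-(2 * a) * s)) s := by
    intro s
    by_cases hs : s ∈ Set.Ioi (0 : ℝ)
    · rw [Set.indicator_of_mem hs, Set.indicator_of_mem hs, ENNReal.toReal_ofNat, Real.rpow_ofNat,
        Real.norm_eq_abs, sq_abs, mul_pow, pow_zero, one_mul, ← Real.exp_nat_mul]
      push_cast
      ring_nf
    · rw [Set.indicator_of_notMem hs, Set.indicator_of_notMem hs]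
      simp
  simp_rw [h1]
  rw [integral_indicator measurableSet_Ioi, integral_const_mul,
    integral_exp_mul_Ioi (by linarith) 0, mul_zero, Real.exp_zero, neg_div_neg_eq, one_div,
    Real.mul_rpow (by positivity) (by positivity), ENNReal.toReal_ofNat, ← Real.rpow_natCast,
    ← Real.rpow_mul (by positivity)]
  norm_num

theorem le_eLpNorm_weightedOrbit (hT : IsC0Semigroup T) (hK0 : 0 < K)
    (hK : ∀ t : ℝ, 0 ≤ t → ‖T t‖ ≤ K) (m : ℕ) {t : ℝ} (ht : 0 < t) (x : X) :
    ENNReal.ofReal ((t / 2) ^ m * Real.exp (-1) * (‖T t x‖ / K) * (t / 2) ^ (2⁻¹ : ℝ)) ≤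
      eLpNorm (weightedOrbit T m t⁻¹ x) 2 := by
  have h1 : ∀ s, ‖(Set.Ioc (t / 2) t).indicator
      (fun _ => (t / 2) ^ m * Real.exp (-1) * (‖T t x‖ / K)) s‖ ≤ ‖weightedOrbit T m t⁻¹ x s‖ := by
    intro s
    by_cases hs : s ∈ Set.Ioc (t / 2) t
    · have hs0 : 0 < s := (half_pos ht).trans hs.1
      have h2 : ‖T t x‖ / K ≤ ‖T s x‖ := by
        rw [div_le_iff₀' hK0]
        have h3 : T t x = T (t - s) (T s x) := by
          rw [← ContinuousLinearMap.comp_apply, ← hT.map_add _ _ (sub_nonneg.2 hs.2) hs0.le,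
            sub_add_cancel]
        rw [h3]
        exact (T (t - s)).le_of_opNorm_le (hK _ (sub_nonneg.2 hs.2)) _
      have h4 : (-(((t⁻¹ : ℝ) : ℂ)) * s).re = -(t⁻¹ * s) := by
        rw [← Complex.ofReal_neg, ← Complex.ofReal_mul, Complex.ofReal_re, neg_mul]
      rw [weightedOrbit, Set.indicator_of_mem hs, Set.indicator_of_mem (Set.mem_Ioi.2 hs0),
        Real.norm_of_nonneg (by positivity), norm_smul, norm_mul, norm_pow, Complex.norm_real,
        Complex.norm_exp, h4, Real.norm_of_nonneg hs0.le]
      have h5 : t⁻¹ * s ≤ 1 := by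
        rw [inv_mul_le_iff₀ ht, mul_one]
        exact hs.2
      have h6 := hs.1.le
      gcongr
    · rw [Set.indicator_of_notMem hs, norm_zero]
      exact norm_nonneg _
  refine le_trans (le_of_eq ?_) (eLpNorm_mono h1)
  rw [eLpNorm_indicator_const measurableSet_Ioc two_ne_zero ENNReal.ofNat_ne_top, Real.volume_Ioc,
    ENNReal.toReal_ofNat, Real.enorm_of_nonneg (by positivity),
    ENNReal.ofReal_rpow_of_nonneg (by linarith) (by norm_num),
    ← ENNReal.ofReal_mul (by positivity), sub_half, one_div]

/-- An `L²` estimate of the higher Laplace-type integrals on a vertical line transfers, by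
Plancherel's theorem, to a decay estimate of the orbit. -/
theorem norm_apply_le_of_laplaceMoment [CompleteSpace X] (hT : IsC0Semigroup T) (hK0 : 0 < K)
    (hK : ∀ t : ℝ, 0 ≤ t → ‖T t‖ ≤ K) (m : ℕ) {t : ℝ} (ht : 0 < t) {x y : X} {N : ℝ} (hN : 0 ≤ N)
    (h : ∀ β : ℝ, ‖laplaceMoment T m ((t⁻¹ : ℝ) + (β : ℂ) * Complex.I) y‖ ≤
      N * ‖laplaceMoment T 0 ((t⁻¹ : ℝ) + (β : ℂ) * Complex.I) x‖) :
    ‖T t y‖ ≤ N * (K ^ 2 * Real.exp 1 * 2 ^ m) / t ^ m * ‖x‖ := by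
  have ha : 0 < t⁻¹ := inv_pos.2 ht
  have h1 : eLpNorm (weightedOrbit T m t⁻¹ y) 2 ≤
      ENNReal.ofReal N * eLpNorm (weightedOrbit T 0 t⁻¹ x) 2 := by
    rw [← eLpNorm_fourier_eq_of_integrable_of_memLp (integrable_weightedOrbit hT hK m ha y)
      (memLp_weightedOrbit hT hK m ha y), ← eLpNorm_fourier_eq_of_integrable_of_memLp
      (integrable_weightedOrbit hT hK 0 ha x) (memLp_weightedOrbit hT hK 0 ha x)]
    refine eLpNorm_le_mul_eLpNorm_of_ae_le_mul (ae_of_all _ fun ξ => ?_) 2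
    rw [fourier_weightedOrbit, fourier_weightedOrbit]
    exact h _
  have h2 := ((le_eLpNorm_weightedOrbit hT hK0 hK m ht y).trans h1).trans
    (mul_le_mul_right (eLpNorm_weightedOrbit_zero_le hK0.le hK ha x) _)
  rw [← ENNReal.ofReal_mul hN, ENNReal.ofReal_le_ofReal_iff (by positivity)] at h2
  have h3 : (2 * t⁻¹)⁻¹ = t / 2 := by field_simp
  rw [h3, ← mul_assoc] at h2
  have h4 := le_of_mul_le_mul_right h2 (by positivity)
  have h5 : (t / 2) ^ m * Real.exp (-1) * (‖T t y‖ / K) =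
      ‖T t y‖ * (t ^ m / (K * Real.exp 1 * 2 ^ m)) := by
    rw [Real.exp_neg, div_pow]
    field_simp
  rw [h5, ← le_div_iff₀ (by positivity)] at h4
  refine h4.trans (le_of_eq ?_)
  field_simp

end TimeDomain

section Decay

theorem HasPosIncrease.exists_pow_le {M : ℝ → ℝ} (h : HasPosIncrease 1 M)
    (hpos : ∀ s, 1 ≤ s → 0 < M s) (hmono : ∀ s t, 1 ≤ s → s ≤ t → M s ≤ M t) :
    ∃ (m : ℕ) (C : ℝ), 0 < C ∧ ∀ σ r t : ℝ, 1 ≤ σ → σ ≤ r → M r ≤ t →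
      M σ ^ (m + 1) / σ ≤ C * (t ^ (m + 1) / r) := by
  obtain ⟨α, hα, c, ⟨hc, hc1⟩, s₀, hs₀, -, H⟩ := h
  have hs₀' : 0 < s₀ := one_pos.trans_le hs₀
  have hs₀α : 1 ≤ s₀ ^ α := Real.one_le_rpow hs₀ hα.le
  have key : ∀ σ r, s₀ ≤ σ → σ ≤ r → M σ * (r / σ) ^ α ≤ c⁻¹ * M r := by
    intro σ r hσ hr
    have hσ0 : 0 < σ := hs₀'.trans_le hσ
    have h1 := H (r / σ) ((one_le_div hσ0).2 hr) σ hσ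
    rw [div_mul_cancel₀ _ hσ0.ne', le_div_iff₀ (hpos σ (hs₀.trans hσ))] at h1
    rw [← div_eq_inv_mul, le_div_iff₀ hc]
    linarith
  have key' : ∀ σ r, 1 ≤ σ → σ ≤ r → M σ * (r / σ) ^ α ≤ (s₀ ^ α * c⁻¹) * M r := by
    intro σ r hσ hr
    have hσ0 : 0 < σ := one_pos.trans_le hσ
    have hr0 : 0 < r := hσ0.trans_le hr
    have hMr := hpos r (hσ.trans hr)
    have hc' : 1 ≤ c⁻¹ := (one_le_inv₀ hc).2 hc1
    rcases le_total s₀ σ with h1 | h1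
    · refine (key σ r h1 hr).trans ?_
      rw [mul_assoc]
      exact le_mul_of_one_le_left (by positivity) hs₀α
    · have h2 : (r / σ) ^ α ≤ r ^ α :=
        Real.rpow_le_rpow (by positivity) (div_le_self hr0.le hσ) hα.le
      rcases le_total s₀ r with h3 | h3
      · have h4 := key s₀ r le_rfl h3
        rw [Real.div_rpow hr0.le hs₀'.le, ← mul_div_assoc, div_le_iff₀ (by positivity)] at h4
        calc M σ * (r / σ) ^ α ≤ M s₀ * r ^ α :=
              mul_le_mul (hmono _ _ hσ h1) h2 (by positivity) (hpos _ hs₀).le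
          _ ≤ _ := by linarith
      · calc M σ * (r / σ) ^ α ≤ M r * s₀ ^ α :=
              mul_le_mul (hmono _ _ hσ hr)
                (h2.trans (Real.rpow_le_rpow hr0.le h3 hα.le)) (by positivity) hMr.le
          _ = s₀ ^ α * 1 * M r := by ring
          _ ≤ _ := by gcongr
  obtain ⟨m, hm⟩ := exists_nat_ge α⁻¹
  have hαm : 1 ≤ α * ((m + 1 : ℕ) : ℝ) := by
    rw [inv_le_iff_one_le_mul₀' hα] at hm
    push_cast
    nlinarith
  refine ⟨m, (s₀ ^ α * c⁻¹) ^ (m + 1), by positivity, fun σ r t hσ hr ht => ?_⟩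
  have hσ0 : 0 < σ := one_pos.trans_le hσ
  have hr0 : 0 < r := hσ0.trans_le hr
  have hMσ := hpos σ hσ
  have hMr := hpos r (hσ.trans hr)
  have h1 : r / σ ≤ ((r / σ) ^ α) ^ (m + 1) := by
    rw [← Real.rpow_natCast, ← Real.rpow_mul (by positivity)]
    exact Real.self_le_rpow_of_one_le ((one_le_div hσ0).2 hr) hαm
  have h2 : (M σ * (r / σ) ^ α) ^ (m + 1) ≤ ((s₀ ^ α * c⁻¹) * t) ^ (m + 1) :=
    pow_le_pow_left₀ (by positivity) ((key' σ r hσ hr).trans (by gcongr)) _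
  rw [mul_pow, mul_pow (s₀ ^ α * c⁻¹)] at h2
  rw [← mul_div_assoc, le_div_iff₀ hr0]
  calc M σ ^ (m + 1) / σ * r = M σ ^ (m + 1) * (r / σ) := by ring
    _ ≤ M σ ^ (m + 1) * ((r / σ) ^ α) ^ (m + 1) := by gcongr
    _ ≤ _ := h2

variable {X : Type*} [NormedAddCommGroup X]

theorem norm_le_of_imaginary [NormedSpace ℂ X] {A : X →ₗ.[ℂ] X} {S P R : X →L[ℂ] X}
    (hS : IsResolvent A 1 S) {β t K : ℝ} (hP : IsResolvent A (Complex.I * (β : ℂ)) P) (ht : 0 < t)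
    (hRn : ‖R‖ ≤ K * t) (hRc : Commute R S)
    (hR : R * (1 + (((t⁻¹ : ℝ) : ℂ) + β * Complex.I - 1) • S) = S) : ‖R‖ ≤ (1 + K) * ‖P‖ := by
  have hne : Complex.I * (β : ℂ) ≠ 1 := fun h => by simpa using congrArg Complex.re h
  have h1 := resolvent_eq_sub_mul (fun x => hS.eq_zero_of_apply_eq_zero) hRc hR
    (hP.commute hS hne) (hP.mul_eq hS)
  have h2 : ((t⁻¹ : ℝ) : ℂ) + β * Complex.I - Complex.I * β = ((t⁻¹ : ℝ) : ℂ) := by ring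
  rw [h2] at h1
  have h3 : ‖(((t⁻¹ : ℝ) : ℂ)) • (P * R)‖ ≤ t⁻¹ * (‖P‖ * (K * t)) := by
    rw [norm_smul, Complex.norm_real, Real.norm_of_nonneg (inv_pos.2 ht).le]
    gcongr
    exact (norm_mul_le _ _).trans (by gcongr)
  calc ‖R‖ ≤ ‖P‖ + t⁻¹ * (‖P‖ * (K * t)) := by
        rw [h1]
        exact (norm_sub_le _ _).trans (by gcongr)
    _ = (1 + K) * ‖P‖ := by field_simp

theorem norm_pow_mul_le_of_imaginary [NormedSpace ℂ X] [CompleteSpace X] {A : X →ₗ.[ℂ] X}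
    {S R : X →L[ℂ] X} {Rop : ℝ → X →L[ℂ] X} {M : ℝ → ℝ} {m : ℕ} {K C : ℝ}
    (hS : IsResolvent A 1 S)
    (hRop : ∀ r : ℝ, r ≠ 0 → IsResolvent A (Complex.I * (r : ℂ)) (Rop r))
    (hlow : ∀ s : ℝ, 1 ≤ s → ∀ r : ℝ, s⁻¹ ≤ |r| → |r| ≤ 1 → ‖Rop r‖ ≤ M s)
    (hhigh : ∀ s : ℝ, 1 ≤ s → ∀ r : ℝ, 1 ≤ |r| → |r| ≤ s → ‖Rop r‖ ≤ M s)
    (hC : 0 < C) (hM : ∀ σ r t : ℝ, 1 ≤ σ → σ ≤ r → M r ≤ t →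
      M σ ^ (m + 1) / σ ≤ C * (t ^ (m + 1) / r)) (hK : 1 ≤ K)
    {r t β : ℝ} (hr : 1 ≤ r) (hrt : r ≤ t) (hMt : M r ≤ t) (hMs : ∀ s, 1 ≤ s → s ≤ M s)
    (hRn : ‖R‖ ≤ K * t) (hRc : Commute R S)
    (hR : R * (1 + (((t⁻¹ : ℝ) : ℂ) + β * Complex.I - 1) • S) = S) :
    ‖R ^ (m + 1) * ((S - 1) * S)‖ ≤
      3 * (1 + K) ^ (m + 1) * (1 + C) * (‖S‖ + 1) ^ 2 * (t ^ (m + 1) / r) := by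
  have hr0 : 0 < r := one_pos.trans_le hr
  have ht0 : 0 < t := hr0.trans_le hrt
  have hK0 : 0 < K := one_pos.trans_le hK
  set E := t ^ (m + 1) / r with hE
  have hE0 : 0 < E := by positivity
  have him : (((t⁻¹ : ℝ) : ℂ) + β * Complex.I).im = β := by simp
  have hzn : ‖((t⁻¹ : ℝ) : ℂ) + β * Complex.I‖ ≤ r⁻¹ + |β| := by
    refine (norm_add_le _ _).trans ?_
    rw [Complex.norm_real, norm_mul, Complex.norm_I, mul_one, Complex.norm_real,
      Real.norm_of_nonneg (inv_pos.2 ht0).le, Real.norm_eq_abs]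
    gcongr
  have hKt : (K * t) ^ (m + 1) / r ≤ (1 + K) ^ (m + 1) * (1 + C) * E := by
    rw [mul_pow, mul_div_assoc]
    gcongr
    calc K ^ (m + 1) ≤ (1 + K) ^ (m + 1) * 1 := by
          rw [mul_one]
          gcongr
          linarith
      _ ≤ _ := by
          gcongr
          linarith
  have hKt1 : 1 ≤ K * t := one_le_mul_of_one_le_of_one_le hK (hr.trans hrt)
  have hMσ : ∀ σ, 1 ≤ σ → σ ≤ r → ((1 + K) * M σ) ^ (m + 1) / σ ≤
      (1 + K) ^ (m + 1) * (1 + C) * E := by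
    intro σ h1 h2
    rw [mul_pow, mul_div_assoc, mul_assoc]
    gcongr
    refine (hM σ r t h1 h2 hMt).trans ?_
    gcongr
    linarith
  have hSS : ‖S‖ ^ 2 ≤ (‖S‖ + 1) ^ 2 := by
    gcongr
    linarith
  set D := (1 + K) ^ (m + 1) * (1 + C) * E with hD
  have hD0 : 0 < D := by positivity
  have hgoal : 3 * (1 + K) ^ (m + 1) * (1 + C) * (‖S‖ + 1) ^ 2 * E = 3 * D * (‖S‖ + 1) ^ 2 := by
    rw [hD]; ring
  rw [hgoal]
  have large : ∀ N σ : ℝ, ‖R‖ ≤ N → 1 ≤ N → 1 ≤ σ → σ ≤ |β| → N ^ (m + 1) / σ ≤ D →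
      ‖R ^ (m + 1) * ((S - 1) * S)‖ ≤ 3 * D * (‖S‖ + 1) ^ 2 := by
    intro N σ h1 h2 h3 h4 h5
    have hσ : 0 < σ := one_pos.trans_le h3
    have hβ : β ≠ 0 := abs_pos.1 (hσ.trans_le h4)
    refine (norm_pow_mul_le_of_im hR h1 h2 (him.trans_ne hβ) m).trans ?_
    rw [him]
    calc N ^ (m + 1) * ((‖S‖ + 1) ^ 2 / |β|) ≤ N ^ (m + 1) * ((‖S‖ + 1) ^ 2 / σ) := by gcongr
      _ = N ^ (m + 1) / σ * (‖S‖ + 1) ^ 2 := by ring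
      _ ≤ D * (‖S‖ + 1) ^ 2 := by gcongr
      _ ≤ 3 * D * (‖S‖ + 1) ^ 2 := by
        gcongr
        linarith
  have small : ∀ N σ : ℝ, ‖R‖ ≤ N → 0 < σ → σ ≤ N → σ ≤ r → |β| ≤ σ⁻¹ → N ^ (m + 1) / σ ≤ D →
      ‖R ^ (m + 1) * ((S - 1) * S)‖ ≤ 3 * D * (‖S‖ + 1) ^ 2 := by
    intro N σ h1 hσ h2 h3 h4 h5
    have hN : 0 < N := hσ.trans_le h2
    refine (norm_pow_mul_le_of_norm hR h1 hN m).trans ?_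
    have h6 : ‖((t⁻¹ : ℝ) : ℂ) + β * Complex.I‖ + N⁻¹ ≤ 3 * σ⁻¹ := by
      have h7 : r⁻¹ ≤ σ⁻¹ := by gcongr
      have h8 : N⁻¹ ≤ σ⁻¹ := by gcongr
      linarith
    calc N ^ (m + 1) * ((‖((t⁻¹ : ℝ) : ℂ) + β * Complex.I‖ + N⁻¹) * ‖S‖ ^ 2)
        ≤ N ^ (m + 1) * ((3 * σ⁻¹) * (‖S‖ + 1) ^ 2) := by gcongr
      _ = 3 * (N ^ (m + 1) / σ) * (‖S‖ + 1) ^ 2 := by ring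
      _ ≤ 3 * D * (‖S‖ + 1) ^ 2 := by gcongr
  have himag : ∀ s, 1 ≤ s → β ≠ 0 → ‖Rop β‖ ≤ M s → ‖R‖ ≤ (1 + K) * M s ∧ s ≤ (1 + K) * M s := by
    intro s hs hβ h
    have h1 := hMs s hs
    exact ⟨(norm_le_of_imaginary hS (hRop β hβ) ht0 hRn hRc hR).trans (by gcongr),
      h1.trans (le_mul_of_one_le_left (by linarith) (by linarith))⟩
  rcases le_total r |β| with h1 | h1
  · exact large (K * t) r hRn hKt1 hr h1 hKt
  rcases le_total 1 |β| with h2 | h2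
  · obtain ⟨h3, h4⟩ := himag |β| h2 (abs_pos.1 (by linarith)) (hhigh _ h2 β h2 le_rfl)
    exact large _ |β| h3 (h2.trans h4) h2 le_rfl (hMσ _ h2 h1)
  rcases le_total r⁻¹ |β| with h3 | h3
  · have hβ : 0 < |β| := (inv_pos.2 hr0).trans_le h3
    have h4 : 1 ≤ |β|⁻¹ := (one_le_inv₀ hβ).2 h2
    have h5 : |β|⁻¹ ≤ r := inv_le_of_inv_le₀ hr0 h3
    obtain ⟨h6, h7⟩ := himag |β|⁻¹ h4 (abs_pos.1 hβ) (hlow _ h4 β (inv_inv _).le h2)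
    exact small _ |β|⁻¹ h6 (by positivity) h7 h5 (inv_inv _).ge (hMσ _ h4 h5)
  · exact small (K * t) r hRn hr0 (hrt.trans (le_mul_of_one_le_left ht0.le hK)) le_rfl h3 hKt

theorem le_of_imaginary_resolvent_le [NormedSpace ℂ X] [CompleteSpace X] {A : X →ₗ.[ℂ] X}
    {Rop : ℝ → X →L[ℂ] X} {M : ℝ → ℝ} (h0 : (0 : ℂ) ∈ pmSpectrum A)
    (hRop : ∀ r : ℝ, r ≠ 0 → IsResolvent A (Complex.I * (r : ℂ)) (Rop r))
    (hlow : ∀ s : ℝ, 1 ≤ s → ∀ r : ℝ, s⁻¹ ≤ |r| → |r| ≤ 1 → ‖Rop r‖ ≤ M s)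
    {s : ℝ} (hs : 1 ≤ s) : s ≤ M s := by
  have hs0 : 0 < s := one_pos.trans_le hs
  have habs : |s⁻¹| = s⁻¹ := abs_of_pos (inv_pos.2 hs0)
  have h1 := (hRop s⁻¹ (inv_ne_zero hs0.ne')).one_le_mul_norm h0
  rw [norm_mul, Complex.norm_I, one_mul, Complex.norm_real, Real.norm_eq_abs, habs,
    le_inv_mul_iff₀ hs0, mul_one] at h1
  exact h1.trans (hlow s hs s⁻¹ habs.ge (habs.le.trans (inv_le_one_of_one_le₀ hs)))

/-- A bound `‖R ^ (m + 1) B‖ ≤ N` along a vertical line, where `B` commutes with the semigroup,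
gives decay of `T(t) B`. -/
theorem norm_comp_le_of_resolvent_pow [InnerProductSpace ℂ X] [CompleteSpace X]
    {T : ℝ → X →L[ℂ] X} {K : ℝ} (hT : IsC0Semigroup T) (hK0 : 0 < K)
    (hK : ∀ t : ℝ, 0 ≤ t → ‖T t‖ ≤ K) {m : ℕ} {t : ℝ} (ht : 0 < t) {B : X →L[ℂ] X} {N : ℝ}
    (hN : 0 ≤ N)
    (h : ∀ β : ℝ, ∃ R : X →L[ℂ] X, Commute R B ∧ ‖R ^ m * B‖ ≤ N ∧ ∀ (n : ℕ) (x : X),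
      laplaceMoment T n ((t⁻¹ : ℝ) + (β : ℂ) * Complex.I) x =
        (n.factorial : ℂ) • (R ^ (n + 1)) x) :
    ‖T t ∘L B‖ ≤ m.factorial * N * (K ^ 2 * Real.exp 1 * 2 ^ m) / t ^ m := by
  refine ContinuousLinearMap.opNorm_le_bound _ (by positivity) fun x => ?_
  refine norm_apply_le_of_laplaceMoment hT hK0 hK m ht (x := x) (y := B x) (by positivity)
    fun β => ?_
  obtain ⟨R, hRB, hRN, hR⟩ := h β
  have h1 : (R ^ (m + 1)) (B x) = (R ^ m * B) (R x) := by
    have : R ^ (m + 1) * B = R ^ m * B * R := by rw [pow_succ, mul_assoc, hRB.eq, mul_assoc]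
    exact congrArg (fun L : X →L[ℂ] X => L x) this
  rw [hR, hR, h1, Nat.factorial_zero, Nat.cast_one, one_smul, zero_add, pow_one, norm_smul,
    Complex.norm_natCast, mul_assoc]
  gcongr
  exact (R ^ m * B).le_of_opNorm_le hRN _

end Decay

/-- Let `X` be a complex Hilbert space and `A` the generator of a bounded
`C₀`-semigroup `(T(t))` on `X`. Suppose `σ(A) ∩ iℝ = {0}` and `M₀, M∞ : [1,∞) → (0,∞)` are
continuous non-decreasing with `sup_{s⁻¹ ≤ |r| ≤ 1} ‖R(i r, A)‖ ≤ M₀ s` and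
`sup_{1 ≤ |r| ≤ s} ‖R(i r, A)‖ ≤ M∞ s` for `s ≥ 1`. If `M = max (M₀, M∞)` has positive
increase, then `‖T(t) A R(1,A)²‖ = O(1 / M⁻¹ t)` as `t → ∞`.
(Note `A R(1,A)² = (R(1,A) - I) R(1,A)`.) -/
theorem statement7 {X : Type*} [NormedAddCommGroup X] [InnerProductSpace ℂ X]
    [CompleteSpace X]
    (T : ℝ → X →L[ℂ] X) (hT : IsC0Semigroup T)
    (hTbdd : ∃ K : ℝ, ∀ t : ℝ, 0 ≤ t → ‖T t‖ ≤ K)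
    (A : X →ₗ.[ℂ] X) (hA : IsGenerator T A)
    (hspec : pmSpectrum A ∩ {z : ℂ | z.re = 0} = {0})
    (Rop : ℝ → X →L[ℂ] X)
    (hRop : ∀ r : ℝ, r ≠ 0 → IsResolvent A (Complex.I * (r : ℂ)) (Rop r))
    (R1 : X →L[ℂ] X) (hR1 : IsResolvent A 1 R1)
    (M₀ Minf : ℝ → ℝ)
    (hM₀pos : ∀ s : ℝ, 1 ≤ s → 0 < M₀ s)
    (hM₀cont : ContinuousOn M₀ (Set.Ici (1 : ℝ)))
    (hM₀mono : ∀ s t : ℝ, 1 ≤ s → s ≤ t → M₀ s ≤ M₀ t)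
    (hMinfpos : ∀ s : ℝ, 1 ≤ s → 0 < Minf s)
    (hMinfcont : ContinuousOn Minf (Set.Ici (1 : ℝ)))
    (hMinfmono : ∀ s t : ℝ, 1 ≤ s → s ≤ t → Minf s ≤ Minf t)
    (hres₀ : ∀ s : ℝ, 1 ≤ s → ∀ r : ℝ, s⁻¹ ≤ |r| → |r| ≤ 1 → ‖Rop r‖ ≤ M₀ s)
    (hresinf : ∀ s : ℝ, 1 ≤ s → ∀ r : ℝ, 1 ≤ |r| → |r| ≤ s → ‖Rop r‖ ≤ Minf s)
    (hMpi : HasPosIncrease 1 (fun s => max (M₀ s) (Minf s))) :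
    ∃ C : ℝ, 0 < C ∧ ∃ t₀ : ℝ, ∀ t : ℝ, t₀ ≤ t →
      ‖T t ∘L ((R1 - 1) ∘L R1)‖ ≤ C / rcInv 1 (fun s => max (M₀ s) (Minf s)) t := by
  obtain ⟨K₀, hK₀⟩ := hTbdd
  obtain ⟨K, hK1, hK⟩ : ∃ K : ℝ, 1 ≤ K ∧ ∀ t : ℝ, 0 ≤ t → ‖T t‖ ≤ K :=
    ⟨max 1 K₀, le_max_left _ _, fun t ht => (hK₀ t ht).trans (le_max_right _ _)⟩
  have hK0 : 0 < K := one_pos.trans_le hK1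
  have h0 : (0 : ℂ) ∈ pmSpectrum A := (hspec.ge rfl).1
  set M : ℝ → ℝ := fun s => max (M₀ s) (Minf s) with hMdef
  have hlow : ∀ s : ℝ, 1 ≤ s → ∀ r : ℝ, s⁻¹ ≤ |r| → |r| ≤ 1 → ‖Rop r‖ ≤ M s :=
    fun s hs r h h' => (hres₀ s hs r h h').trans (le_max_left _ _)
  have hhigh : ∀ s : ℝ, 1 ≤ s → ∀ r : ℝ, 1 ≤ |r| → |r| ≤ s → ‖Rop r‖ ≤ M s :=
    fun s hs r h h' => (hresinf s hs r h h').trans (le_max_right _ _)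
  have hMs : ∀ s, 1 ≤ s → s ≤ M s := fun s => le_of_imaginary_resolvent_le h0 hRop hlow
  obtain ⟨m, C, hC, hM⟩ := hMpi.exists_pow_le (fun s hs => (hM₀pos s hs).trans_le (le_max_left _ _))
    (fun s t hs hst => max_le_max (hM₀mono s t hs hst) (hMinfmono s t hs hst))
  set D := 3 * (1 + K) ^ (m + 1) * (1 + C) * (‖R1‖ + 1) ^ 2 with hD
  have hD0 : 0 < D := by positivity
  have key : ∀ r t : ℝ, 1 ≤ r → M r ≤ t → ‖T t ∘L ((R1 - 1) ∘L R1)‖ ≤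
      ((m + 1).factorial * D * (K ^ 2 * Real.exp 1 * 2 ^ (m + 1))) / r := by
    intro r t hr hMt
    have hrt : r ≤ t := (hMs r hr).trans hMt
    have hr0 : 0 < r := one_pos.trans_le hr
    have ht0 : 0 < t := hr0.trans_le hrt
    refine (norm_comp_le_of_resolvent_pow hT hK0 hK (m := m + 1) ht0 (B := (R1 - 1) * R1)
      (N := D * (t ^ (m + 1) / r)) (by positivity) fun β => ?_).trans (le_of_eq ?_)
    · have hre : (((t⁻¹ : ℝ) : ℂ) + β * Complex.I).re = t⁻¹ := by simp
      obtain ⟨R, hRn, hRc, hR, hRL⟩ := hA.exists_laplace_resolvent hT hK hR1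
        (z := ((t⁻¹ : ℝ) : ℂ) + β * Complex.I) (by rw [hre]; positivity)
      rw [hre, div_inv_eq_mul] at hRn
      exact ⟨R, (hRc.sub_right (Commute.one_right R)).mul_right hRc,
        norm_pow_mul_le_of_imaginary hR1 hRop hlow hhigh hC hM hK1 hr hrt hMt hMs hRn hRc hR,
        hRL⟩
    · field_simp
  refine ⟨(m + 1).factorial * D * (K ^ 2 * Real.exp 1 * 2 ^ (m + 1)), by positivity, M 1,
    fun t ht => ?_⟩
  have hbdd : BddAbove {r : ℝ | 1 ≤ r ∧ M r ≤ t} := ⟨t, fun r hr => (hMs r hr.1).trans hr.2⟩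
  have h1 : 1 ≤ rcInv 1 M t := le_csSup hbdd ⟨le_rfl, ht⟩
  rw [le_div_iff₀ (one_pos.trans_le h1)]
  rcases (norm_nonneg (T t ∘L ((R1 - 1) ∘L R1))).eq_or_lt with h2 | h2
  · rw [← h2, zero_mul]
    positivity
  · rw [← le_div_iff₀' h2]
    refine csSup_le ⟨1, le_rfl, ht⟩ fun r hr => ?_
    rw [le_div_iff₀' h2, ← le_div_iff₀ (one_pos.trans_le hr.1)]
    exact key r t hr.1 hr.2

end
end

section
/- Let X be a complex Banach space and let A be the generator of a C₀-semigroup (T(t))_{t≥0} on X. Suppose that 0 ∈ σ(A) ⊆ {z ∈ ℂ : Re z < 0} ∪ {0} and that M₀, M_∞ : [1,∞) → (0,∞) are continuous non-decreasing functions such that, for some δ ∈ (0,1], δ·M₀(s) ≤ sup_{s⁻¹ ≤ |r| ≤ 1} 1/dist(ir, σ(A)) ≤ sup_{s⁻¹ ≤ |r| ≤ 1} ‖R(ir,A)‖ ≤ M₀(s) and δ·M_∞(s) ≤ sup_{1 ≤ |r| ≤ s} 1/dist(ir, σ(A)) ≤ sup_{1 ≤ |r| ≤ s} ‖R(ir,A)‖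 ≤ M_∞(s) for all s ≥ 1. Define M(s) = max{M₀(s), M_∞(s)}, s ≥ 1. If ‖T(t)AR(1,A)²‖ = O(1/M⁻¹(ct)) as t → ∞ for some c > 0, then M has positive increase. -/
open Filter Topology MeasureTheory

noncomputable section

namespace IsResolvent

variable {X : Type*} [NormedAddCommGroup X] [NormedSpace ℂ X]

/-- If `R` is the resolvent of `A` at `z` and `1 + (w - z) R` is invertible, then `w` lies in the
resolvent set of `A`. -/
theorem notMem_pmSpectrum_of_isUnit {A : X →ₗ.[ℂ] X} {z w : ℂ} {R : X →L[ℂ] X}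
    (hR : IsResolvent A z R) (hU : IsUnit (1 + (w - z) • R)) : w ∉ pmSpectrum A := by
  obtain ⟨U, hU⟩ := hU
  have h1 : ∀ x, (↑U⁻¹ : X →L[ℂ] X) x + (w - z) • R ((↑U⁻¹ : X →L[ℂ] X) x) = x := fun x => by
    simpa [hU] using DFunLike.congr_fun U.mul_inv x
  have h2 : ∀ x, (↑U⁻¹ : X →L[ℂ] X) (x + (w - z) • R x) = x := fun x => by
    simpa [hU] using DFunLike.congr_fun U.inv_mul x
  refine fun h => h ⟨R ∘L (↑U⁻¹ : X →L[ℂ] X), fun x => hR.mem_domain _, fun x => ?_, fun y => ?_⟩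
  · have h3 := hR.right_inv ((↑U⁻¹ : X →L[ℂ] X) x)
    have h4 := h1 x
    rw [sub_smul] at h4
    have h5 := sub_add_sub_cancel' (z • R ((↑U⁻¹ : X →L[ℂ] X) x)) 
      (A ⟨_, hR.mem_domain ((↑U⁻¹ : X →L[ℂ] X) x)⟩) (w • R ((↑U⁻¹ : X →L[ℂ] X) x))
    rw [h3] at h5
    exact h5.symm.trans h4
  · have h3 := hR.left_inv y
    have h4 := h2 (z • (y : X) - A y)
    rw [h3, sub_smul] at h4
    rw [ContinuousLinearMap.comp_apply]
    rw [show w • (y : X) - A y = z • (y : X) - A y + (w • (y : X) - z • (y : X)) by abel, h4, h3]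

/-- Every point of the resolvent set has positive distance to a nonempty spectrum. -/
theorem infDist_pmSpectrum_pos [CompleteSpace X] {A : X →ₗ.[ℂ] X} {z : ℂ} {R : X →L[ℂ] X}
    (hR : IsResolvent A z R) (hne : (pmSpectrum A).Nonempty) :
    0 < Metric.infDist z (pmSpectrum A) := by
  have hpos : (0 : ℝ) < (‖R‖ + 1)⁻¹ := by positivity
  refine hpos.trans_le ((Metric.le_infDist hne).2 fun w hw => ?_)
  by_contra! hlt
  refine hR.notMem_pmSpectrum_of_isUnit ?_ hw
  rw [show 1 + (w - z) • R = 1 - (z - w) • R by rw [← neg_sub z w, neg_smul, ← sub_eq_add_neg]]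
  refine isUnit_one_sub_of_norm_lt_one ?_
  rw [norm_smul, ← dist_eq_norm]
  have h1 : dist z w * (‖R‖ + 1) < 1 := by
    rwa [← lt_div_iff₀ (by positivity), one_div]
  nlinarith [dist_nonneg (x := z) (y := w)]

end IsResolvent

namespace IsC0Semigroup

variable {X : Type*} [NormedAddCommGroup X] [NormedSpace ℂ X]

theorem tendsto_apply_generator {T : ℝ → X →L[ℂ] X} {A : X →ₗ.[ℂ] X} (hA : IsGenerator T A)
    {s : ℝ} (y : A.domain) :
    Tendsto (fun h : ℝ => h⁻¹ • (T s (T h (y : X)) - T s (y : X))) (𝓝[>] (0 : ℝ))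
      (𝓝 (T s (A y))) := by
  refine (((T s).continuous.tendsto _).comp (hA.tendsto_generator y)).congr fun h => ?_
  simp [← map_sub]

theorem hasDerivWithinAt {T : ℝ → X →L[ℂ] X} (hT : IsC0Semigroup T) {A : X →ₗ.[ℂ] X}
    (hA : IsGenerator T A) {s : ℝ} (hs : 0 ≤ s) (y : A.domain) :
    HasDerivWithinAt (fun t => T t (y : X)) (T s (A y)) (Set.Ioi s) s := by
  rw [hasDerivWithinAt_iff_tendsto_slope' (by simp)]
  have hsub : Tendsto (fun t : ℝ => t - s) (𝓝[>] s) (𝓝[>] 0) := by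
    refine tendsto_nhdsWithin_iff.2 ⟨?_, ?_⟩
    · have : Tendsto (fun t : ℝ => t - s) (𝓝 s) (𝓝 (s - s)) :=
        (continuous_id.sub continuous_const).tendsto s
      rw [sub_self] at this
      exact this.mono_left nhdsWithin_le_nhds
    · filter_upwards [self_mem_nhdsWithin] with t ht
      exact sub_pos.2 (Set.mem_Ioi.1 ht)
  refine ((tendsto_apply_generator hA y).comp hsub).congr' ?_
  filter_upwards [self_mem_nhdsWithin] with t ht
  have h := hT.map_add s (t - s) hs (sub_nonneg.2 (le_of_lt ht))
  rw [add_sub_cancel] at h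
  simp [slope, h]

theorem apply_mem_domain {T : ℝ → X →L[ℂ] X} (hT : IsC0Semigroup T) {A : X →ₗ.[ℂ] X}
    (hA : IsGenerator T A) {s : ℝ} (hs : 0 ≤ s) (y : A.domain) :
    ∃ h : T s (y : X) ∈ A.domain, A ⟨T s (y : X), h⟩ = T s (A y) := by
  have key : Tendsto (fun h : ℝ => h⁻¹ • (T h (T s (y : X)) - T s (y : X))) (𝓝[>] (0 : ℝ))
      (𝓝 (T s (A y))) := by
    refine (tendsto_apply_generator hA y).congr' ?_
    filter_upwards [self_mem_nhdsWithin] with h hh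
    have h1 := hT.map_add s h hs (le_of_lt hh)
    rw [add_comm, hT.map_add h s (le_of_lt hh) hs] at h1
    rw [← ContinuousLinearMap.comp_apply, ← h1, ContinuousLinearMap.comp_apply]
  have hmem : T s (y : X) ∈ A.domain := (hA.mem_domain_iff _).2 ⟨_, key⟩
  exact ⟨hmem, tendsto_nhds_unique (hA.tendsto_generator ⟨_, hmem⟩) key⟩

theorem apply_resolvent {T : ℝ → X →L[ℂ] X} (hT : IsC0Semigroup T) {A : X →ₗ.[ℂ] X}
    (hA : IsGenerator T A) {z : ℂ} {R : X →L[ℂ] X} (hR : IsResolvent A z R)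
    {s : ℝ} (hs : 0 ≤ s) (x : X) : T s (R x) = R (T s x) := by
  obtain ⟨hmem, hAT⟩ := hT.apply_mem_domain hA hs ⟨R x, hR.mem_domain x⟩
  have h := hR.left_inv ⟨_, hmem⟩
  rw [hAT, ← map_smul, ← map_sub, hR.right_inv] at h
  exact h.symm

theorem continuousOn_exp_smul {T : ℝ → X →L[ℂ] X} (hT : IsC0Semigroup T) (l : ℂ) (t : ℝ) (x : X) :
    ContinuousOn (fun s : ℝ => Complex.exp (-(l * s)) • T s x) (Set.Icc 0 t) := by
  refine ContinuousOn.smul (Continuous.continuousOn (by fun_prop)) ?_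
  exact (hT.strong_continuity x).mono Set.Icc_subset_Ici_self

theorem intervalIntegrable_exp_smul {T : ℝ → X →L[ℂ] X} (hT : IsC0Semigroup T) (l : ℂ) {t : ℝ}
    (ht : 0 ≤ t) (x : X) :
    IntervalIntegrable (fun s : ℝ => Complex.exp (-(l * s)) • T s x) volume 0 t :=
  ContinuousOn.intervalIntegrable (by simpa [Set.uIcc_of_le ht] using hT.continuousOn_exp_smul l t x)

/-- The operator `x ↦ ∫₀ᵗ e^{-ls} T(s) x ds` is bounded. -/
theorem exists_integral_operator [CompleteSpace X] {T : ℝ → X →L[ℂ] X} (hT : IsC0Semigroup T)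
    (l : ℂ) {t : ℝ} (ht : 0 ≤ t) :
    ∃ S : X →L[ℂ] X, ∀ x, S x = ∫ s in (0 : ℝ)..t, Complex.exp (-(l * s)) • T s x := by
  obtain ⟨K, hK⟩ := banach_steinhaus
    (g := fun s : Set.Icc (0 : ℝ) t => Complex.exp (-(l * (s : ℝ))) • T s) fun x => by
      obtain ⟨C, hC⟩ := isCompact_Icc.exists_bound_of_continuousOn (hT.continuousOn_exp_smul l t x)
      exact ⟨C, fun s => hC s s.2⟩
  let S : X →ₗ[ℂ] X :=
    { toFun := fun x => ∫ s in (0 : ℝ)..t, Complex.exp (-(l * s)) • T s x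
      map_add' := fun x y => by
        simp only [_root_.map_add, smul_add]
        exact intervalIntegral.integral_add (hT.intervalIntegrable_exp_smul l ht x)
          (hT.intervalIntegrable_exp_smul l ht y)
      map_smul' := fun a x => by
        rw [RingHom.id_apply, ← intervalIntegral.integral_smul]
        refine intervalIntegral.integral_congr fun s _ => ?_
        rw [map_smul, smul_comm] }
  refine ⟨S.mkContinuous (K * |t - 0|) fun x => ?_, fun x => rfl⟩
  have h := intervalIntegral.norm_integral_le_of_norm_le_const (a := 0) (b := t) (C := K * ‖x‖)
    (f := fun s : ℝ => Complex.exp (-(l * s)) • T s x) fun s hs => by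
      rw [Set.uIoc_of_le ht] at hs
      exact (Complex.exp (-(l * s)) • T s).le_of_opNorm_le (hK ⟨s, hs.1.le, hs.2⟩) x
  calc ‖S x‖ ≤ K * ‖x‖ * |t - 0| := h
    _ = K * |t - 0| * ‖x‖ := by ring

theorem integral_exp_smul_generator [CompleteSpace X] {T : ℝ → X →L[ℂ] X} (hT : IsC0Semigroup T)
    {A : X →ₗ.[ℂ] X} (hA : IsGenerator T A) (l : ℂ) {t : ℝ} (ht : 0 ≤ t) (y : A.domain) :
    ∫ s in (0 : ℝ)..t, Complex.exp (-(l * s)) • T s (A y - l • (y : X)) =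
      Complex.exp (-(l * t)) • T t (y : X) - y := by
  rw [intervalIntegral.integral_eq_sub_of_hasDeriv_right
    (f := fun s : ℝ => Complex.exp (-(l * s)) • T s (y : X))]
  · simp [hT.map_zero]
  · simpa [Set.uIcc_of_le ht] using hT.continuousOn_exp_smul l t (y : X)
  · intro s hs
    rw [min_eq_left ht] at hs
    have hexp : HasDerivAt (fun s : ℝ => Complex.exp (-(l * s))) (Complex.exp (-(l * s)) * -l) s := by
      have h1 : HasDerivAt (fun s : ℝ => -(l * (s : ℂ))) (-l) s := by
        exact ((Complex.ofRealCLM.hasDerivAt (x := s)).const_mul l).neg.congr_deriv (by simp)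
      exact h1.cexp
    refine (hexp.hasDerivWithinAt.smul (hT.hasDerivWithinAt hA hs.1.le y)).congr_deriv ?_
    rw [map_sub, map_smul, smul_sub, smul_smul, mul_neg, neg_smul, sub_eq_add_neg]
  · exact hT.intervalIntegrable_exp_smul l ht _

/-- Spectral inclusion for `T(t) A R(1, A)²`, in the form of a lower norm bound. -/
theorem norm_le_of_mem_pmSpectrum [CompleteSpace X] {T : ℝ → X →L[ℂ] X} (hT : IsC0Semigroup T)
    {A : X →ₗ.[ℂ] X} (hA : IsGenerator T A) {R : X →L[ℂ] X} (hR : IsResolvent A 1 R) {l : ℂ}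
    (hl : l ∈ pmSpectrum A) {t : ℝ} (ht : 0 ≤ t) :
    Real.exp (t * l.re) * (‖l‖ / ‖1 - l‖ ^ 2) ≤ ‖T t ∘L ((R - 1) ∘L R)‖ := by
  have hl1 : 1 - l ≠ 0 := by
    rintro h
    rw [sub_eq_zero] at h
    exact hl ⟨R, h ▸ hR⟩
  obtain ⟨S, hS⟩ := hT.exists_integral_operator l ht
  set N : X →L[ℂ] X := 1 + (l - 1) • R with hN
  have hAR : ∀ x, A ⟨R x, hR.mem_domain x⟩ = R x - x := fun x => by
    have h := hR.right_inv x
    rw [one_smul] at h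
    exact eq_sub_of_add_eq' (sub_eq_iff_eq_add.1 h).symm
  have hSR : Commute S R := by
    ext x
    simp only [mul_apply_eq_comp, hS]
    rw [← ContinuousLinearMap.intervalIntegral_comp_comm _ (hT.intervalIntegrable_exp_smul l ht x)]
    refine intervalIntegral.integral_congr fun s hs => ?_
    rw [Set.uIcc_of_le ht] at hs
    simp [hT.apply_resolvent hA hR hs.1]
  have hTR : T t * R = Complex.exp (l * t) • (R - S * N) := by
    have h : Complex.exp (-(l * t)) • (T t * R) = R - S * N := by
      ext x
      have h := hT.integral_exp_smul_generator hA l ht ⟨R x, hR.mem_domain x⟩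
      rw [← hS, hAR] at h
      have h2 : R x - x - l • R x = -(N x) := by
        simp [hN, sub_smul]
        abel
      simp only [h2, map_neg] at h
      change Complex.exp (-(l * t)) • T t (R x) = R x - S (N x)
      rw [sub_eq_add_neg, h]
      abel
    rw [← h, smul_smul, ← Complex.exp_add]
    simp
  by_contra! hlt
  set B : X →L[ℂ] X := T t ∘L ((R - 1) ∘L R) with hB
  set μ : ℂ := Complex.exp (l * t) * (l / (1 - l) ^ 2) with hμ
  have hμn : ‖μ‖ = Real.exp (t * l.re) * (‖l‖ / ‖1 - l‖ ^ 2) := by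
    rw [hμ, norm_mul, Complex.norm_exp, norm_div, norm_pow]
    simp [mul_comm]
  have hunit : IsUnit (algebraMap ℂ (X →L[ℂ] X) μ - B) := by
    have : μ ∈ resolventSet ℂ B := spectrum.mem_resolventSet_of_norm_lt_mul (by
      refine lt_of_le_of_lt ?_ (hlt.trans_eq hμn.symm)
      refine (mul_le_of_le_one_right (norm_nonneg _) ?_)
      exact ContinuousLinearMap.norm_id_le)
    exact this
  have hfact : ∃ W : X →L[ℂ] X, Commute W N ∧ algebraMap ℂ (X →L[ℂ] X) μ - B = W * N := by
    have hRN : Commute R N := by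
      rw [hN]
      exact (Commute.one_right R).add_right ((Commute.refl R).smul_right _)
    have hSN : Commute S N := by
      rw [hN]
      exact (Commute.one_right S).add_right (hSR.smul_right _)
    refine ⟨Complex.exp (l * t) • ((1 - l)⁻¹ • (R + ((1 - l)⁻¹ - 1) • 1) + S * (R - 1)), ?_, ?_⟩
    · refine Commute.smul_left (Commute.add_left (Commute.smul_left (Commute.add_left hRN
        (Commute.smul_left (Commute.one_left N) _)) _) ?_) _
      exact Commute.mul_left hSN (hRN.sub_left (Commute.one_left N))
    · have hBeq : B = Complex.exp (l * t) • ((R - S * N) * (R - 1)) := by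
        have : B = T t * R * (R - 1) := by
          rw [hB]
          change T t * ((R - 1) * R) = _
          noncomm_ring
        rw [this, hTR, smul_mul_assoc]
      have hNR : N * (R - 1) = (R - 1) * N := (hRN.sub_left (Commute.one_left N)).symm
      have hscal : algebraMap ℂ (X →L[ℂ] X) μ =
          Complex.exp (l * t) • ((l / (1 - l) ^ 2) • (1 : X →L[ℂ] X)) := by
        rw [Algebra.algebraMap_eq_smul_one, smul_smul]
      have hmain : (l / (1 - l) ^ 2) • (1 : X →L[ℂ] X) - R * (R - 1) =
          (1 - l)⁻¹ • (R + ((1 - l)⁻¹ - 1) • 1) * N := by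
        rw [hN, show l - 1 = -(1 - l) by ring, show l = 1 - (1 - l) by ring]
        generalize 1 - l = a at hl1
        simp only [sub_sub_cancel]
        simp only [mul_add, mul_sub, add_mul, smul_add, smul_mul_assoc, mul_smul_comm, mul_one,
          one_mul, smul_smul]
        match_scalars <;> field_simp
        ring
      rw [hBeq, hscal, ← smul_sub, smul_mul_assoc, add_mul, ← hmain, sub_mul, mul_assoc S N, hNR,
        mul_assoc S (R - 1) N]
      congr 1
      abel
  obtain ⟨W, hWN, hW⟩ := hfact
  rw [hW] at hunit
  exact hR.notMem_pmSpectrum_of_isUnit (hWN.isUnit_mul_iff.1 hunit).2 hl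

end IsC0Semigroup

/-- A positive monotone function that at least doubles under a fixed dilation has positive
increase. -/
theorem hasPosIncrease_of_two_mul_le {M : ℝ → ℝ} {a s₀ L : ℝ} (ha : a ≤ s₀) (hs₀ : 0 < s₀)
    (hL : 1 < L) (hpos : ∀ s, s₀ ≤ s → 0 < M s) (hmono : MonotoneOn M (Set.Ici s₀))
    (hdouble : ∀ s, s₀ ≤ s → 2 * M s ≤ M (L * s)) : HasPosIncrease a M := by
  have hlog : 0 < Real.log L := Real.log_pos hL
  have hL0 : 0 < L := by linarith
  have hpow : ∀ n : ℕ, ∀ s, s₀ ≤ s → 2 ^ n * M s ≤ M (L ^ n * s) := by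
    intro n
    induction n with
    | zero => simp
    | succ n ih =>
      intro s hs
      have h1 : s₀ ≤ L ^ n * s := hs.trans
        (le_mul_of_one_le_left (hs₀.le.trans hs) (one_le_pow₀ hL.le))
      have h2 := hdouble _ h1
      have h3 := ih s hs
      rw [show L ^ (n + 1) * s = L * (L ^ n * s) by ring, pow_succ]
      linarith
  have hLα : L ^ (Real.log 2 / Real.log L) = 2 := by
    rw [Real.rpow_def_of_pos hL0, mul_div_cancel₀ _ hlog.ne', Real.exp_log two_pos]
  have hα : 0 < Real.log 2 / Real.log L := div_pos (Real.log_pos one_lt_two) hlog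
  refine ⟨Real.log 2 / Real.log L, hα, 1 / 2, by norm_num, s₀, ha, hs₀, fun lam hlam s hs => ?_⟩
  obtain ⟨n, hn1, hn2⟩ := exists_nat_pow_near hlam hL
  rw [le_div_iff₀ (hpos s hs)]
  have h1 : lam ^ (Real.log 2 / Real.log L) ≤ 2 ^ (n + 1) := by
    calc lam ^ (Real.log 2 / Real.log L) ≤ (L ^ (n + 1)) ^ (Real.log 2 / Real.log L) :=
          Real.rpow_le_rpow (by linarith) hn2.le hα.le
      _ = 2 ^ (n + 1) := by rw [← Real.rpow_pow_comm hL0.le, hLα]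
  have hs0 : 0 ≤ s := hs₀.le.trans hs
  have h2 : M (L ^ n * s) ≤ M (lam * s) := by
    refine hmono (hs.trans (le_mul_of_one_le_left hs0 (one_le_pow₀ hL.le)))
      (hs.trans (le_mul_of_one_le_left hs0 hlam)) ?_
    gcongr
  have h3 := hpow n s hs
  have h4 := mul_le_mul_of_nonneg_right h1 (hpos s hs).le
  rw [pow_succ] at h4
  linarith

/-- A lower bound on the supremum of reciprocal distances yields a point of the set that is close
to one of the points `i r`. -/
theorem exists_mem_dist_lt_of_lt_iSup_infDist_inv {σ : Set ℂ} (hσ : σ.Nonempty) {p : ℝ → Prop}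
    [Nonempty {r : ℝ // p r}] {m : ℝ} (hm : 0 < m)
    (h : m < ⨆ r : {r : ℝ // p r}, (Metric.infDist (Complex.I * ((r : ℝ) : ℂ)) σ)⁻¹) :
    ∃ r : ℝ, p r ∧ ∃ l ∈ σ, dist (Complex.I * (r : ℂ)) l < m⁻¹ := by
  obtain ⟨⟨r, hr⟩, hlt⟩ := exists_lt_of_lt_ciSup h
  have hd : Metric.infDist (Complex.I * (r : ℂ)) σ < m⁻¹ := by
    have h1 := inv_strictAnti₀ hm hlt
    rwa [inv_inv] at h1
  exact ⟨r, hr, (Metric.infDist_lt_iff hσ).1 hd⟩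

/-- Let `X` be a complex Banach space and `A` the generator of a
`C₀`-semigroup `(T(t))` on `X`. Suppose `0 ∈ σ(A) ⊆ {Re z < 0} ∪ {0}` and that
`M₀, M∞ : [1,∞) → (0,∞)` are continuous non-decreasing functions squeezed (up to a
constant `δ ∈ (0,1]`) between `sup dist(i r, σ(A))⁻¹` and themselves as in the statement,
over `s⁻¹ ≤ |r| ≤ 1` resp. `1 ≤ |r| ≤ s`. Let `M = max (M₀, M∞)`. If
`‖T(t) A R(1,A)²‖ = O(1 / M⁻¹ (c t))` as `t → ∞` for some `c > 0`, then `M` has positive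
increase. (Note `A R(1,A)² = (R(1,A) - I) R(1,A)`.) -/
theorem statement8 {X : Type*} [NormedAddCommGroup X] [NormedSpace ℂ X] [CompleteSpace X]
    (T : ℝ → X →L[ℂ] X) (hT : IsC0Semigroup T)
    (A : X →ₗ.[ℂ] X) (hA : IsGenerator T A)
    (hzero : (0 : ℂ) ∈ pmSpectrum A)
    (hspec : pmSpectrum A ⊆ {z : ℂ | z.re < 0} ∪ {0})
    (Rop : ℝ → X →L[ℂ] X)
    (hRop : ∀ r : ℝ, r ≠ 0 → IsResolvent A (Complex.I * (r : ℂ)) (Rop r))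
    (R1 : X →L[ℂ] X) (hR1 : IsResolvent A 1 R1)
    (M₀ Minf : ℝ → ℝ)
    (hM₀pos : ∀ s : ℝ, 1 ≤ s → 0 < M₀ s)
    (hM₀cont : ContinuousOn M₀ (Set.Ici (1 : ℝ)))
    (hM₀mono : ∀ s t : ℝ, 1 ≤ s → s ≤ t → M₀ s ≤ M₀ t)
    (hMinfpos : ∀ s : ℝ, 1 ≤ s → 0 < Minf s)
    (hMinfcont : ContinuousOn Minf (Set.Ici (1 : ℝ)))
    (hMinfmono : ∀ s t : ℝ, 1 ≤ s → s ≤ t → Minf s ≤ Minf t)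
    (δ : ℝ) (hδ : δ ∈ Set.Ioc (0 : ℝ) 1)
    (hchain₀ : ∀ s : ℝ, 1 ≤ s →
      δ * M₀ s ≤
          (⨆ r : {r : ℝ // s⁻¹ ≤ |r| ∧ |r| ≤ 1},
            (Metric.infDist (Complex.I * ((r : ℝ) : ℂ)) (pmSpectrum A))⁻¹) ∧
      (⨆ r : {r : ℝ // s⁻¹ ≤ |r| ∧ |r| ≤ 1},
            (Metric.infDist (Complex.I * ((r : ℝ) : ℂ)) (pmSpectrum A))⁻¹) ≤
          (⨆ r : {r : ℝ // s⁻¹ ≤ |r| ∧ |r| ≤ 1}, ‖Rop (r : ℝ)‖) ∧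
      (⨆ r : {r : ℝ // s⁻¹ ≤ |r| ∧ |r| ≤ 1}, ‖Rop (r : ℝ)‖) ≤ M₀ s)
    (hchaininf : ∀ s : ℝ, 1 ≤ s →
      δ * Minf s ≤
          (⨆ r : {r : ℝ // 1 ≤ |r| ∧ |r| ≤ s},
            (Metric.infDist (Complex.I * ((r : ℝ) : ℂ)) (pmSpectrum A))⁻¹) ∧
      (⨆ r : {r : ℝ // 1 ≤ |r| ∧ |r| ≤ s},
            (Metric.infDist (Complex.I * ((r : ℝ) : ℂ)) (pmSpectrum A))⁻¹) ≤
          (⨆ r : {r : ℝ // 1 ≤ |r| ∧ |r| ≤ s}, ‖Rop (r : ℝ)‖) ∧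
      (⨆ r : {r : ℝ // 1 ≤ |r| ∧ |r| ≤ s}, ‖Rop (r : ℝ)‖) ≤ Minf s)
    (c : ℝ) (hc : 0 < c)
    (hO : ∃ C : ℝ, 0 < C ∧ ∃ t₀ : ℝ, ∀ t : ℝ, t₀ ≤ t →
      ‖T t ∘L ((R1 - 1) ∘L R1)‖ ≤
        C / rcInv 1 (fun s => max (M₀ s) (Minf s)) (c * t)) :
    HasPosIncrease 1 (fun s => max (M₀ s) (Minf s)) := by
  obtain ⟨hδ0, hδ1⟩ := hδ
  obtain ⟨C, hC, t₀, hO⟩ := hO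
  have hne : (pmSpectrum A).Nonempty := ⟨0, hzero⟩
  have hM₀ge : ∀ s : ℝ, 1 ≤ s → s ≤ M₀ s := by
    intro s hs
    have hs0 : 0 < s := by linarith
    obtain ⟨h1, h2, h3⟩ := hchain₀ s hs
    have hbdd : BddAbove (Set.range fun r : {r : ℝ // s⁻¹ ≤ |r| ∧ |r| ≤ 1} =>
        (Metric.infDist (Complex.I * ((r : ℝ) : ℂ)) (pmSpectrum A))⁻¹) := by
      by_contra hb
      rw [Real.iSup_of_not_bddAbove hb] at h1
      linarith [mul_pos hδ0 (hM₀pos s hs)]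
    have habs : |s⁻¹| = s⁻¹ := abs_of_pos (inv_pos.2 hs0)
    have h4 := le_ciSup hbdd ⟨s⁻¹, habs.ge, habs.trans_le (inv_le_one_of_one_le₀ hs)⟩
    refine le_trans ?_ (h4.trans (h2.trans h3))
    have h5 := (hRop s⁻¹ (inv_ne_zero hs0.ne')).infDist_pmSpectrum_pos hne
    rw [le_inv_comm₀ hs0 h5]
    refine (Metric.infDist_le_dist_of_mem hzero).trans ?_
    rw [dist_zero_right, norm_mul, Complex.norm_I, one_mul, Complex.norm_real, Real.norm_eq_abs,
      habs]
  set M : ℝ → ℝ := fun s => max (M₀ s) (Minf s) with hM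
  have hMge : ∀ s : ℝ, 1 ≤ s → s ≤ M s := fun s hs => (hM₀ge s hs).trans (le_max_left _ _)
  have hMmono : MonotoneOn M (Set.Ici 1) := fun s hs t _ hst =>
    max_le_max (hM₀mono s t hs hst) (hMinfmono s t hs hst)
  have hlam : ∀ s : ℝ, 1 ≤ s → 4 / δ * s < M s → ∃ l ∈ pmSpectrum A,
      -(2 / (δ * M s)) ≤ l.re ∧ (14 * s)⁻¹ ≤ ‖l‖ / ‖1 - l‖ ^ 2 := by
    intro s hs hK
    have hs0 : 0 < s := by linarith
    have hMs : 0 < M s := hs0.trans_le (hMge s hs)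
    have hm : 0 < δ * M s / 2 := by positivity
    have hsmall : (δ * M s / 2)⁻¹ ≤ s⁻¹ / 2 := by
      rw [inv_le_comm₀ hm (by positivity)]
      have h1 : δ * (4 / δ * s) < δ * M s := mul_lt_mul_of_pos_left hK hδ0
      rw [← mul_assoc, mul_div_cancel₀ _ hδ0.ne'] at h1
      rw [inv_div, div_inv_eq_mul]
      linarith
    have hs1 : s⁻¹ ≤ 1 := inv_le_one_of_one_le₀ hs
    have hre : ∀ (r : ℝ) (l : ℂ), dist (Complex.I * (r : ℂ)) l < (δ * M s / 2)⁻¹ →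
        -(2 / (δ * M s)) ≤ l.re ∧ |r| - s⁻¹ / 2 ≤ ‖l‖ ∧ ‖l‖ ≤ |r| + s⁻¹ / 2 ∧ l ≠ 1 := by
      intro r l hl
      have h0 : ‖Complex.I * (r : ℂ)‖ = |r| := by simp
      rw [dist_eq_norm] at hl
      have h1 := (Complex.abs_re_le_norm (Complex.I * (r : ℂ) - l)).trans hl.le
      have h2 : (Complex.I * (r : ℂ) - l).re = -l.re := by simp
      rw [h2, abs_neg] at h1
      have h3 := abs_norm_sub_norm_le (Complex.I * (r : ℂ)) l
      rw [h0, abs_le] at h3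
      refine ⟨?_, by linarith, by linarith, ?_⟩
      · rw [inv_div] at h1
        exact (abs_le.1 h1).1
      · rintro rfl
        rw [Complex.one_re, abs_one] at h1
        linarith
    have hfin : ∀ l : ℂ, l ≠ 1 → ‖1 - l‖ ^ 2 ≤ ‖l‖ * (14 * s) →
        (14 * s)⁻¹ ≤ ‖l‖ / ‖1 - l‖ ^ 2 := by
      intro l hl h
      have : 0 < ‖1 - l‖ := norm_pos_iff.2 (sub_ne_zero.2 hl.symm)
      rw [inv_eq_one_div, div_le_div_iff₀ (by positivity) (by positivity)]
      linarith
    have htri : ∀ l : ℂ, ‖1 - l‖ ≤ 1 + ‖l‖ := fun l => by simpa using norm_sub_le (1 : ℂ) l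
    rcases max_choice (M₀ s) (Minf s) with hmax | hmax
    · have : Nonempty {r : ℝ // s⁻¹ ≤ |r| ∧ |r| ≤ 1} := ⟨1, by simpa using hs1⟩
      have hMeq : M s = M₀ s := hmax
      obtain ⟨r, ⟨hr1, hr2⟩, l, hl, hd⟩ := exists_mem_dist_lt_of_lt_iSup_infDist_inv hne hm
        (lt_of_lt_of_le (by rw [← hMeq]; linarith) (hchain₀ s hs).1)
      obtain ⟨hre1, hlow, hup, hl1⟩ := hre r l hd
      refine ⟨l, hl, hre1, hfin l hl1 ?_⟩
      have h1 : ‖1 - l‖ ≤ 5 / 2 := (htri l).trans (by linarith)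
      have h2 : ‖1 - l‖ ^ 2 ≤ (5 / 2) ^ 2 := by gcongr
      have h3 : s⁻¹ / 2 * (14 * s) ≤ ‖l‖ * (14 * s) := by
        gcongr
        linarith
      have h4 : s⁻¹ / 2 * (14 * s) = 7 := by field_simp; norm_num
      linarith
    · have : Nonempty {r : ℝ // 1 ≤ |r| ∧ |r| ≤ s} := ⟨1, by simpa using hs⟩
      have hMeq : M s = Minf s := hmax
      obtain ⟨r, ⟨hr1, hr2⟩, l, hl, hd⟩ := exists_mem_dist_lt_of_lt_iSup_infDist_inv hne hm
        (lt_of_lt_of_le (by rw [← hMeq]; linarith) (hchaininf s hs).1)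
      obtain ⟨hre1, hlow, hup, hl1⟩ := hre r l hd
      refine ⟨l, hl, hre1, hfin l hl1 ?_⟩
      have h1 : ‖1 - l‖ ≤ 3 * ‖l‖ := (htri l).trans (by linarith)
      have h2 : ‖1 - l‖ ^ 2 ≤ (3 * ‖l‖) ^ 2 := by gcongr
      nlinarith [norm_nonneg l]
  have hinv : ∀ s : ℝ, 1 ≤ s → s ≤ rcInv 1 M (M s) := fun s hs =>
    le_csSup ⟨M s, fun r hr => (hMge r hr.1).trans hr.2⟩ ⟨hs, le_rfl⟩
  set L : ℝ := 14 * C * Real.exp (4 / (c * δ)) + 8 / δ with hLdef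
  have hL8 : 8 / δ < L := by
    have : 0 < 14 * C * Real.exp (4 / (c * δ)) := by positivity
    linarith
  have h8 : 8 ≤ 8 / δ := by
    rw [le_div_iff₀ hδ0]
    linarith
  have hL1 : 1 < L := by linarith
  refine hasPosIncrease_of_two_mul_le (s₀ := max 1 (c * t₀)) (L := L) (le_max_left _ _)
    (lt_max_of_lt_left one_pos) hL1 (fun s hs => ?_) (hMmono.mono ?_) (fun s hs => ?_)
  · have hs1 := (le_max_left _ _).trans hs
    linarith [hMge s hs1]
  · exact Set.Ici_subset_Ici.2 (le_max_left _ _)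
  have hs1 : 1 ≤ s := (le_max_left _ _).trans hs
  have hst : c * t₀ ≤ s := (le_max_right _ _).trans hs
  have hs0 : 0 < s := by linarith
  have hMs : 0 < M s := hs0.trans_le (hMge s hs1)
  have hsL : s ≤ L * s := le_mul_of_one_le_left hs0.le hL1.le
  have hMLs := hMge (L * s) (hs1.trans hsL)
  rcases le_or_gt (M s) (4 / δ * s) with hK | hK
  · have h1 : 8 / δ * s ≤ L * s := by gcongr
    have h2 : 8 / δ * s = 2 * (4 / δ * s) := by ring
    linarith
  obtain ⟨l, hl, hre, hquot⟩ := hlam s hs1 hK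
  by_contra! hlt
  set t : ℝ := M (L * s) / c with htdef
  have hct : c * t = M (L * s) := mul_div_cancel₀ _ hc.ne'
  have ht : t₀ ≤ t := by
    rw [htdef, le_div_iff₀ hc]
    linarith
  have ht0 : 0 ≤ t := div_nonneg (by linarith) hc.le
  have h1 := (hT.norm_le_of_mem_pmSpectrum hA hR1 hl ht0).trans (hO t ht)
  rw [hct] at h1
  have hLs0 : 0 < L * s := by linarith
  have h2 : C / rcInv 1 M (M (L * s)) ≤ C / (L * s) := by
    gcongr
    exact hinv _ (hs1.trans hsL)
  have hexp : -(4 / (c * δ)) ≤ t * l.re := by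
    have h3 : t * (2 / (δ * M s)) ≤ 4 / (c * δ) := by
      rw [htdef, div_mul_div_comm, div_le_div_iff₀ (by positivity) (by positivity)]
      nlinarith [mul_pos hc hδ0]
    have h4 := mul_le_mul_of_nonneg_left hre ht0
    linarith
  have h3 : Real.exp (-(4 / (c * δ))) * (14 * s)⁻¹ ≤ C / (L * s) :=
    (mul_le_mul (Real.exp_le_exp.2 hexp) hquot (by positivity) (Real.exp_nonneg _)).trans
      (h1.trans h2)
  rw [Real.exp_neg, ← mul_inv, inv_eq_one_div, div_le_div_iff₀ (by positivity) hLs0] at h3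
  have h4 : L * s ≤ (14 * C * Real.exp (4 / (c * δ))) * s := by linarith
  have h5 := le_of_mul_le_mul_right h4 hs0
  linarith

end
end
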